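/- Let G be a minor-minimal enemy. Then every edge uv ∈ E(G) satisfies |N(u) ∩ N(v)| ≥ 4, i.e., the endpoints of every edge have at least four common neighbors. -/

import Mathlib

open SimpleGraph

/-- `K7vee` is the graph obtained from `K 7` by deleting two edges with a common end. -/
def K7vee : SimpleGraph (Fin 7) :=
  (completeGraph (Fin 7)).deleteEdges {s(0, 1), s(0, 2)}

/-- `K6vee` is the graph obtained from `K 6` by deleting two edges with a common end. -/
def K6vee : SimpleGraph (Fin 6) :=
  (completeGraph (Fin 6)).deleteEdges {s(0, 1), s(0, 2)}

/-- The complete multipartite graph with four parts of size two. -/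
def K2222 : SimpleGraph (Fin 4 × Fin 2) :=
  SimpleGraph.comap Prod.fst (completeGraph (Fin 4))

/-- `H` is a minor of `G`: there is a model of `H` in `G`, i.e. a family of pairwise disjoint
nonempty connected branch sets, one for each vertex of `H`, with edges of `G` between branch
sets corresponding to adjacent vertices of `H`. -/
def IsMinor {W V : Type} (H : SimpleGraph W) (G : SimpleGraph V) : Prop :=
  ∃ bag : W → Set V,
    (∀ w, (G.induce (bag w)).Connected) ∧
    (∀ w w', w ≠ w' → Disjoint (bag w) (bag w')) ∧
    (∀ w w', H.Adj w w' → ∃ u ∈ bag w, ∃ v ∈ bag w', G.Adj u v)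

/-- A graph is `k`-connected if it has more than `k` vertices and stays connected after
removing any set of fewer than `k` vertices. -/
def IsKConnected {V : Type} [Fintype V] (k : ℕ) (G : SimpleGraph V) : Prop :=
  k < Fintype.card V ∧ ∀ S : Set V, S.ncard < k → (G.induce (Sᶜ : Set V)).Connected

/-- A separation of `G`: `A ∪ B = V(G)` and no edge joins `A - B` to `B - A`. -/
def IsSeparation {V : Type} (G : SimpleGraph V) (A B : Set V) : Prop :=
  A ∪ B = Set.univ ∧ ∀ ⦃u v : V⦄, G.Adj u v → ¬(u ∈ A \ B ∧ v ∈ B \ A)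

/-- `(G, Z)` is internally `k`-connected: every separation `(A,B)` of `G` with `Z ⊆ A`
and `B - A ≠ ∅` has order at least `k`. -/
def InternallyConnected {V : Type} (G : SimpleGraph V) (Z : Set V) (k : ℕ) : Prop :=
  ∀ A B : Set V, IsSeparation G A B → Z ⊆ A → (B \ A).Nonempty →
    k ≤ (A ∩ B).ncard

/-- A `Z`-rooted `K₄`-model in `G`. -/
def HasRootedK4Model {V : Type} (G : SimpleGraph V) (Z : Set V) : Prop :=
  ∃ B : Fin 4 → Set V,
    (∀ i, (G.induce (B i)).Connected) ∧
    (∀ i j, i ≠ j → Disjoint (B i) (B j)) ∧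
    (∀ i, ∃! z : V, z ∈ Z ∧ z ∈ B i) ∧
    (∀ z ∈ Z, ∃ i, z ∈ B i) ∧
    (∀ i j, i ≠ j → ∃ u ∈ B i, ∃ v ∈ B j, G.Adj u v)

/-- A `Z`-rooted `K*₄,₂`-model in `G`. -/
def HasRootedK42starModel {V : Type} (G : SimpleGraph V) (Z : Set V) : Prop :=
  ∃ (B : Fin 4 → Set V) (C : Fin 2 → Set V),
    (∀ i, (G.induce (B i)).Connected) ∧
    (∀ j, (G.induce (C j)).Connected) ∧
    (∀ i j, i ≠ j → Disjoint (B i) (B j)) ∧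
    (∀ i j, i ≠ j → Disjoint (C i) (C j)) ∧
    (∀ i j, Disjoint (B i) (C j)) ∧
    (∀ i, ∃! z : V, z ∈ Z ∧ z ∈ B i) ∧
    (∀ z ∈ Z, ∃ i, z ∈ B i) ∧
    (∀ i j, ∃ u ∈ B i, ∃ v ∈ C j, G.Adj u v) ∧
    (∃ u ∈ C 0, ∃ v ∈ C 1, G.Adj u v)

/-- An enemy: a `4`-connected graph with `|E(G)| ≥ 4|V(G)| - 8`, with no `K7vee`-minor,
not isomorphic to `K_{2,2,2,2}`. -/
def Enemy {V : Type} [Fintype V] (G : SimpleGraph V) : Prop :=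
  IsKConnected 4 G ∧
    4 * (Fintype.card V : ℤ) - 8 ≤ (G.edgeSet.ncard : ℤ) ∧
    ¬ IsMinor K7vee G ∧
    IsEmpty (G ≃g K2222)

/-- A minor-minimal enemy: an enemy, no minor of which, other than itself, is an enemy. -/
def MinorMinimalEnemy {V : Type} [Fintype V] (G : SimpleGraph V) : Prop :=
  Enemy G ∧ ∀ (W : Type) [Fintype W] (H : SimpleGraph W),
    IsMinor H G → Enemy H → Nonempty (H ≃g G)

/-- The simple graph obtained from `G` by contracting the edge `uv`
(`v` is merged into `u`). -/
def contractEdge {V : Type} (G : SimpleGraph V) (u v : V) :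
    SimpleGraph {x : V // x ≠ v} :=
  SimpleGraph.fromRel (fun x y => G.Adj ↑x ↑y ∨ ((x : V) = u ∧ G.Adj v ↑y))

/-- A graph is `7`-contraction-critical if its chromatic number is `7` and
every minor of it, other than itself, has chromatic number less than `7`. -/
def ContractionCritical7 {V : Type} [Fintype V] (G : SimpleGraph V) : Prop :=
  G.chromaticNumber = 7 ∧
    ∀ (W : Type) [Fintype W] (H : SimpleGraph W),
      IsMinor H G → IsEmpty (H ≃g G) → H.chromaticNumber < 7

section Prelim

variable {V W U : Type}

/-- The set of vertices outside `A` with a neighbour in `A`. -/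
def bdry (G : SimpleGraph V) (A : Set V) : Set V :=
  {v | v ∉ A ∧ ∃ a ∈ A, G.Adj a v}

/-- Connectedness of a vertex set, phrased with cuts. -/
def Conn (G : SimpleGraph V) (S : Set V) : Prop :=
  S.Nonempty ∧ ∀ A ⊆ S, A.Nonempty → (S \ A).Nonempty → ∃ a ∈ A, ∃ b ∈ S \ A, G.Adj a b

/-- Every nonempty set of vertices whose closed neighbourhood is not everything has at least four
boundary vertices. -/
def Bdry4 (G : SimpleGraph V) : Prop :=
  ∀ A : Set V, A.Nonempty → (∃ b, b ∉ A ∧ b ∉ bdry G A) → 4 ≤ (bdry G A).ncard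

theorem conn_iff (G : SimpleGraph V) (S : Set V) : (G.induce S).Connected ↔ Conn G S := by
  constructor
  · intro h
    refine ⟨Set.nonempty_coe_sort.1 h.nonempty, ?_⟩
    rintro A hA ⟨a, ha⟩ ⟨b, hb⟩
    obtain ⟨p⟩ := h.preconnected ⟨a, hA ha⟩ ⟨b, hb.1⟩
    obtain ⟨d, -, hd1, hd2⟩ := p.exists_boundary_dart {x | (x : V) ∈ A} ha hb.2
    exact ⟨_, hd1, _, ⟨d.snd.2, hd2⟩, d.adj⟩
  · rintro ⟨⟨s, hs⟩, h⟩
    have : Nonempty S := ⟨⟨s, hs⟩⟩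
    refine ⟨fun u v => ?_⟩
    by_contra hn
    obtain ⟨a, ⟨ha, hau⟩, b, ⟨hb, hbu⟩, hab⟩ := h {x | ∃ hx : x ∈ S, (G.induce S).Reachable u ⟨x, hx⟩}
      (fun x hx => hx.1) ⟨u, u.2, SimpleGraph.Reachable.refl _⟩
      ⟨v, v.2, fun hv => hn hv.2⟩
    refine hbu ⟨hb, hau.trans ?_⟩
    exact SimpleGraph.Adj.reachable (G := G.induce S) (u := ⟨a, ha⟩) (v := ⟨b, hb⟩) hab

theorem conn_singleton (G : SimpleGraph V) (v : V) : Conn G {v} := by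
  refine ⟨⟨v, rfl⟩, ?_⟩
  rintro A hA ⟨a, ha⟩ ⟨b, hb, hb'⟩
  have h1 := hA ha
  simp only [Set.mem_singleton_iff] at h1 hb
  subst h1; subst hb
  exact absurd ha hb'

theorem Conn.union {G : SimpleGraph V} {S T : Set V} (hS : Conn G S) (hT : Conn G T)
    (h : ∃ s ∈ S, ∃ t ∈ T, G.Adj s t) : Conn G (S ∪ T) := by
  obtain ⟨s, hs, t, ht, hst⟩ := h
  refine ⟨⟨s, Or.inl hs⟩, ?_⟩
  intro A hA hne hne'
  by_cases h1 : (S ∩ A).Nonempty ∧ (S \ A).Nonempty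
  · obtain ⟨a, ha, b, hb, hab⟩ := hS.2 (S ∩ A) Set.inter_subset_left h1.1 (by
      obtain ⟨x, hx⟩ := h1.2; exact ⟨x, hx.1, fun h => hx.2 h.2⟩)
    exact ⟨a, ha.2, b, ⟨Or.inl hb.1, fun h => hb.2 ⟨hb.1, h⟩⟩, hab⟩
  by_cases h2 : (T ∩ A).Nonempty ∧ (T \ A).Nonempty
  · obtain ⟨a, ha, b, hb, hab⟩ := hT.2 (T ∩ A) Set.inter_subset_left h2.1 (by
      obtain ⟨x, hx⟩ := h2.2; exact ⟨x, hx.1, fun h => hx.2 h.2⟩)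
    exact ⟨a, ha.2, b, ⟨Or.inr hb.1, fun h => hb.2 ⟨hb.1, h⟩⟩, hab⟩
  have key : ∀ R : Set V, ¬ ((R ∩ A).Nonempty ∧ (R \ A).Nonempty) → R ⊆ A ∨ ∀ x ∈ R, x ∉ A := by
    intro R hR
    by_cases hx : ∃ x ∈ R, x ∈ A
    · obtain ⟨x, hx, hxA⟩ := hx
      left; intro y hy; by_contra hyA
      exact hR ⟨⟨x, hx, hxA⟩, ⟨y, hy, hyA⟩⟩
    · right; intro x hx' hxA; exact hx ⟨x, hx', hxA⟩
  obtain ⟨a, ha⟩ := hne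
  obtain ⟨b, hb, hb'⟩ := hne'
  rcases key S h1 with h1 | h1 <;> rcases key T h2 with h2 | h2
  · exact absurd (hb.elim (fun h => h1 h) (fun h => h2 h)) hb'
  · exact ⟨s, h1 hs, t, ⟨Or.inr ht, h2 t ht⟩, hst⟩
  · exact ⟨t, h2 ht, s, ⟨Or.inl hs, h1 s hs⟩, hst.symm⟩
  · exact ((hA ha).elim (fun h => h1 a h ha) (fun h => h2 a h ha)).elim

/-- A union of connected sets indexed by a connected set of a graph is connected, when adjacent
indices have sets joined by an edge. -/
theorem Conn.biUnion {G : SimpleGraph V} {H : SimpleGraph W} {bag : W → Set V} {T : Set W}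
    (hT : Conn H T) (hb : ∀ w ∈ T, Conn G (bag w))
    (hadj : ∀ w w', H.Adj w w' → ∃ u ∈ bag w, ∃ v ∈ bag w', G.Adj u v) :
    Conn G (⋃ w ∈ T, bag w) := by
  obtain ⟨⟨t, ht⟩, hT⟩ := hT
  obtain ⟨x, hx⟩ := (hb t ht).1
  refine ⟨⟨x, Set.mem_biUnion ht hx⟩, ?_⟩
  rintro A hA ⟨a, ha⟩ ⟨b, hb1, hb2⟩
  by_contra hno
  push Not at hno
  have key : ∀ w ∈ T, (∃ y ∈ bag w, y ∈ A) → bag w ⊆ A := by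
    rintro w hw ⟨y, hy, hyA⟩ z hz
    by_contra hzA
    obtain ⟨c, hc, d, hd, hcd⟩ := (hb w hw).2 (bag w ∩ A) Set.inter_subset_left ⟨y, hy, hyA⟩
      ⟨z, hz, fun h => hzA h.2⟩
    exact hno c hc.2 d ⟨Set.mem_biUnion hw hd.1, fun h => hd.2 ⟨hd.1, h⟩⟩ hcd
  simp only [Set.mem_iUnion] at hb1
  have haU := hA ha
  simp only [Set.mem_iUnion] at haU
  obtain ⟨wa, hwa, hawa⟩ := haU
  obtain ⟨wb, hwb, hbwb⟩ := hb1
  obtain ⟨c, ⟨hc, hcA⟩, d, ⟨hd, hdA⟩, hcd⟩ := hT {w | w ∈ T ∧ bag w ⊆ A} (fun w hw => hw.1)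
    ⟨wa, hwa, key wa hwa ⟨a, hawa, ha⟩⟩ ⟨wb, hwb, fun h => hb2 (h.2 hbwb)⟩
  obtain ⟨u, hu, v, hv, huv⟩ := hadj c d hcd
  refine hno u (hcA hu) v ⟨Set.mem_biUnion hd hv, fun hvA => hdA ⟨hd, key d hd ⟨v, hv, hvA⟩⟩⟩ huv

theorem IsMinor.trans {A : SimpleGraph U} {B : SimpleGraph W} {C : SimpleGraph V}
    (h1 : IsMinor A B) (h2 : IsMinor B C) : IsMinor A C := by
  obtain ⟨f, f1, f2, f3⟩ := h1
  obtain ⟨g, g1, g2, g3⟩ := h2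
  refine ⟨fun u => ⋃ w ∈ f u, g w, fun u => ?_, fun u u' h => ?_, fun u u' h => ?_⟩
  · exact (conn_iff _ _).2 (((conn_iff _ _).1 (f1 u)).biUnion (fun w _ => (conn_iff _ _).1 (g1 w)) g3)
  · simp only [Set.disjoint_iUnion_left, Set.disjoint_iUnion_right]
    intro w hw w' hw'
    refine g2 w' w ?_
    rintro rfl
    exact Set.disjoint_left.1 (f2 u u' h) hw' hw
  · obtain ⟨w, hw, w', hw', hww⟩ := f3 u u' h
    obtain ⟨x, hx, y, hy, hxy⟩ := g3 w w' hww
    exact ⟨x, Set.mem_biUnion hw hx, y, Set.mem_biUnion hw' hy, hxy⟩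

theorem bdry4_of_isKConnected [Fintype V] {G : SimpleGraph V} (h : IsKConnected 4 G) :
    Bdry4 G := by
  rintro A ⟨a, ha⟩ ⟨b, hb, hb'⟩
  by_contra hlt
  have hc := (conn_iff _ _).1 (h.2 (bdry G A) (by omega))
  obtain ⟨c, hc, d, hd, hcd⟩ := hc.2 A (fun x hx hx' => hx'.1 hx) ⟨a, ha⟩ ⟨b, hb', hb⟩
  exact hd.1 ⟨hd.2, c, hc, hcd⟩

theorem isKConnected_of_bdry4 [Fintype V] {G : SimpleGraph V} (h : Bdry4 G)
    (hc : 4 < Fintype.card V) : IsKConnected 4 G := by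
  refine ⟨hc, fun S hS => (conn_iff _ _).2 ⟨?_, ?_⟩⟩
  · by_contra hne
    rw [Set.not_nonempty_iff_eq_empty, Set.compl_empty_iff] at hne
    rw [hne, Set.ncard_univ, Nat.card_eq_fintype_card] at hS
    omega
  · rintro A hA hne ⟨b, hb, hbA⟩
    by_contra hno
    push Not at hno
    have hsub : bdry G A ⊆ S := by
      rintro v ⟨hv, a, ha, hav⟩
      by_contra hvS
      exact hno a ha v ⟨hvS, hv⟩ hav
    have := h A hne ⟨b, hbA, fun hb' => hb (hsub hb')⟩
    have := Set.ncard_le_ncard hsub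
    omega

end Prelim

section Components

variable {V : Type} {G : SimpleGraph V}

theorem exists_max_set [Finite V] (P : Set V → Prop) (h : ∃ S, P S) :
    ∃ S, P S ∧ ∀ T, P T → T.ncard ≤ S.ncard :=
  Set.exists_max_image {S | P S} Set.ncard (Set.toFinite _) h

theorem exists_min_set [Finite V] (P : Set V → Prop) (h : ∃ S, P S) :
    ∃ S, P S ∧ ∀ T, P T → S.ncard ≤ T.ncard :=
  Set.exists_min_image {S | P S} Set.ncard (Set.toFinite _) h

/-- `K` is a nonempty connected subset of `S` with no edge to the rest of `S`. -/
def IsComp (G : SimpleGraph V) (S K : Set V) : Prop :=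
  K ⊆ S ∧ Conn G K ∧ ∀ a ∈ K, ∀ b ∈ S, G.Adj a b → b ∈ K

theorem exists_isComp [Finite V] {S : Set V} {v : V} (hv : v ∈ S) :
    ∃ K, IsComp G S K ∧ v ∈ K := by
  obtain ⟨K, ⟨hKS, hvK, hK⟩, hmax⟩ := exists_max_set (fun K => K ⊆ S ∧ v ∈ K ∧ Conn G K)
    ⟨{v}, by simpa using hv, rfl, conn_singleton G v⟩
  refine ⟨K, ⟨hKS, hK, fun a ha b hb hab => ?_⟩, hvK⟩
  by_contra hbK
  have h1 := hmax (K ∪ {b}) ⟨Set.union_subset hKS (by simpa using hb), Or.inl hvK,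
    hK.union (conn_singleton G b) ⟨a, ha, b, rfl, hab⟩⟩
  rw [Set.union_singleton, Set.ncard_insert_of_notMem hbK] at h1
  omega

theorem IsComp.subset_of_meets {S K B : Set V} (hK : IsComp G S K) (hB : Conn G B) (hBS : B ⊆ S)
    (h : ∃ x ∈ B, x ∈ K) : B ⊆ K := by
  obtain ⟨x, hx, hxK⟩ := h
  intro y hy
  by_contra hyK
  obtain ⟨a, ha, b, hb, hab⟩ := hB.2 (B ∩ K) Set.inter_subset_left ⟨x, hx, hxK⟩
    ⟨y, hy, fun h => hyK h.2⟩
  exact hb.2 ⟨hb.1, hK.2.2 a ha.2 b (hBS hb.1) hab⟩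

theorem Conn.diff_comp {M K : Set V} {w : V} (hM : Conn G M) (hw : w ∈ M)
    (hK : IsComp G (M \ {w}) K) : Conn G (M \ K) := by
  have hwK : w ∉ K := fun h => (hK.1 h).2 rfl
  refine ⟨⟨w, hw, hwK⟩, fun A hA hne hne' => ?_⟩
  by_cases hwA : w ∈ A
  · obtain ⟨a, ha, b, hb, hab⟩ := hM.2 ((M \ K) \ A) (fun x hx => hx.1.1) hne'
      ⟨w, hw, fun h => h.2 hwA⟩
    refine ⟨b, ?_, a, ha, hab.symm⟩
    by_contra hbA
    have hbK : b ∈ K := by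
      by_contra hbK
      exact hb.2 ⟨⟨hb.1, hbK⟩, hbA⟩
    exact ha.1.2 (hK.2.2 b hbK a ⟨ha.1.1, fun h => ha.2 (h ▸ hwA)⟩ hab.symm)
  · obtain ⟨b, hb⟩ := hne'
    obtain ⟨a, ha, c, hc, hac⟩ := hM.2 A (fun x hx => (hA hx).1) hne ⟨b, hb.1.1, hb.2⟩
    refine ⟨a, ha, c, ⟨⟨hc.1, fun hcK => ?_⟩, hc.2⟩, hac⟩
    exact (hA ha).2 (hK.2.2 c hcK a ⟨(hA ha).1, fun h => hwA (h ▸ ha)⟩ hac.symm)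

theorem exists_isComp_disjoint [Finite V] {S B : Set V} (hS : ¬ Conn G S) (hB : Conn G B)
    (hBS : B ⊆ S) : ∃ K, IsComp G S K ∧ Disjoint B K := by
  obtain ⟨b, hb⟩ := hB.1
  obtain ⟨C, hC, hbC⟩ := exists_isComp (G := G) (hBS hb)
  have hBC := hC.subset_of_meets hB hBS ⟨b, hb, hbC⟩
  have hne : ∃ v ∈ S, v ∉ C := by
    by_contra hno
    push Not at hno
    exact hS (Set.Subset.antisymm hC.1 hno ▸ hC.2.1)
  obtain ⟨v, hv, hvC⟩ := hne
  obtain ⟨K, hK, hvK⟩ := exists_isComp (G := G) hv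
  refine ⟨K, hK, Set.disjoint_left.2 fun x hxB hxK => hvC ?_⟩
  exact hC.subset_of_meets hK.2.1 hK.1 ⟨x, hxK, hBC hxB⟩ hvK

end Components

section Attach

variable {V : Type} {G : SimpleGraph V}

/-- The members of `O` with a neighbour in `Y`. -/
def att (G : SimpleGraph V) (O Y : Set V) : Set V :=
  {o | o ∈ O ∧ ∃ y ∈ Y, G.Adj y o}

theorem att_mono {O Y Z : Set V} (h : Y ⊆ Z) : att G O Y ⊆ att G O Z :=
  fun _ ⟨ho, y, hy, hyo⟩ => ⟨ho, y, h hy, hyo⟩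

theorem att_union (O Y Z : Set V) : att G O (Y ∪ Z) = att G O Y ∪ att G O Z := by
  ext o
  constructor
  · rintro ⟨ho, y, hy | hy, hyo⟩
    · exact Or.inl ⟨ho, y, hy, hyo⟩
    · exact Or.inr ⟨ho, y, hy, hyo⟩
  · exact fun h => h.elim (fun h => att_mono Set.subset_union_left h)
      (fun h => att_mono Set.subset_union_right h)

/-- The properties of a connected set `X`, attached to a six-element set `O`, that together are
contradictory. -/
structure OctaSide (G : SimpleGraph V) (X O : Set V) : Prop where
  conn : Conn G X
  two_le : 2 ≤ X.ncard
  card_eq : O.ncard = 6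
  att_eq : att G O X = O
  four_le : ∀ Y ⊆ X, Y.Nonempty → 4 ≤ (X ∩ bdry G Y).ncard + (att G O Y).ncard
  split : ∀ Y ⊆ X, Conn G Y → Conn G (X \ Y) → (att G O Y).ncard ≤ 2 ∨
    (att G O (X \ Y)).ncard ≤ 2 ∨ (Disjoint (att G O Y) (att G O (X \ Y)) ∧
      (att G O Y).ncard = 3 ∧ (att G O (X \ Y)).ncard = 3)
  four_le_of_unique : ∀ o ∈ O, ∀ w ∈ X, G.Adj w o → (∀ x ∈ X, G.Adj x o → x = w) →
    4 ≤ (att G O {w}).ncard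

namespace OctaSide

variable {X O : Set V}

theorem att_split (h : OctaSide G X O) {Y : Set V} (hY : Y ⊆ X) :
    att G O Y ∪ att G O (X \ Y) = O := by
  rw [← att_union, Set.union_sdiff_cancel hY, h.att_eq]

theorem six_le [Finite V] (h : OctaSide G X O) {Y : Set V} (hY : Y ⊆ X) :
    6 ≤ (att G O Y).ncard + (att G O (X \ Y)).ncard := by
  have h1 := Set.ncard_union_le (att G O Y) (att G O (X \ Y))
  rwa [h.att_split hY, h.card_eq] at h1

theorem three_le_att_of_isComp [Finite V] (h : OctaSide G X O) {K : Set V} {w : V}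
    (hK : Conn G K) (hKX : K ⊆ X) (hw : X ∩ bdry G K ⊆ {w}) : 3 ≤ (att G O K).ncard := by
  have h1 := h.four_le K hKX hK.1
  have h2 := Set.ncard_le_ncard hw
  rw [Set.ncard_singleton] at h2
  omega

theorem bdry_comp_subset {M K : Set V} {w : V} (hK : IsComp G (M \ {w}) K) :
    M ∩ bdry G K ⊆ {w} := by
  rintro b ⟨hb, hbK, a, ha, hab⟩
  by_contra hbw
  exact hbK (hK.2.2 a ha b ⟨hb, hbw⟩ hab)

theorem exists_ne [Finite V] (h : OctaSide G X O) (w : V) : ∃ v ∈ X, v ≠ w := by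
  by_contra hno
  push Not at hno
  have h1 : X ⊆ {w} := hno
  have h2 := Set.ncard_le_ncard h1
  rw [Set.ncard_singleton] at h2
  have := h.two_le
  omega

theorem att_singleton_le [Finite V] (h : OctaSide G X O) {w : V} (hw : w ∈ X) :
    (att G O {w}).ncard ≤ 3 := by
  by_contra hlt
  obtain ⟨v, hv, hvw⟩ := h.exists_ne w
  obtain ⟨K, hK, hvK⟩ := exists_isComp (G := G) (S := X \ {w}) ⟨hv, hvw⟩
  have hKX : K ⊆ X := fun x hx => (hK.1 hx).1
  have h1 := h.three_le_att_of_isComp hK.2.1 hKX (bdry_comp_subset hK)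
  have h2 : (att G O {w}).ncard ≤ (att G O (X \ K)).ncard :=
    Set.ncard_le_ncard (att_mono (by
      rw [Set.singleton_subset_iff]; exact ⟨hw, fun h => (hK.1 h).2 rfl⟩))
  have h3 := h.split K hKX hK.2.1 (h.conn.diff_comp hw hK)
  omega

theorem not_unique [Finite V] (h : OctaSide G X O) {o w : V} (hw : w ∈ X)
    (ho : o ∈ att G O {w}) (hu : ∀ x ∈ X, G.Adj x o → x = w) : False := by
  obtain ⟨hoO, w', hw', hwo⟩ := ho
  rw [Set.mem_singleton_iff] at hw'
  subst hw'
  have := h.four_le_of_unique o hoO _ hw hwo hu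
  have := h.att_singleton_le hw
  omega

theorem exists_small_part [Finite V] (h : OctaSide G X O) :
    ∃ Y ⊆ X, Conn G Y ∧ Conn G (X \ Y) ∧ (att G O Y).ncard ≤ 2 := by
  obtain ⟨w, hw⟩ := h.conn.1
  obtain ⟨v, hv, hvw⟩ := h.exists_ne w
  obtain ⟨K, hK, -⟩ := exists_isComp (G := G) (S := X \ {w}) ⟨hv, hvw⟩
  obtain ⟨Y, ⟨hYX, hY, hM⟩, hmin⟩ := exists_min_set
    (fun Y => Y ⊆ X ∧ Conn G Y ∧ Conn G (X \ Y))
    ⟨K, fun x hx => (hK.1 hx).1, hK.2.1, h.conn.diff_comp hw hK⟩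
  obtain ⟨y, hy, m, hm, hym⟩ := h.conn.2 Y hYX hY.1 hM.1
  have hYy : Y = {y} := by
    refine Set.Subset.antisymm (fun z hz => ?_) (by simpa using hy)
    by_contra hzy
    obtain ⟨K, hK, -⟩ := exists_isComp (G := G) (S := Y \ {y}) ⟨hz, hzy⟩
    have hKY : K ⊆ Y := fun x hx => (hK.1 hx).1
    have hyK : y ∉ K := fun h => (hK.1 h).2 rfl
    have h1 := hmin K ⟨hKY.trans hYX, hK.2.1, by
      have h2 := (hY.diff_comp hy hK).union hM ⟨y, ⟨hy, hyK⟩, m, hm, hym⟩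
      convert h2 using 1
      ext x
      have := @hYX x
      have := @hKY x
      simp only [Set.mem_union, Set.mem_sdiff]
      tauto⟩
    have h3 := Set.ncard_lt_ncard (s := K) (t := Y) ⟨hKY, fun h => hyK (h hy)⟩
    omega
  refine ⟨Y, hYX, hY, hM, ?_⟩
  have h1 := h.att_singleton_le (hYX hy)
  rw [← hYy] at h1
  have h2 := h.six_le hYX
  rcases h.split Y hYX hY hM with h3 | h3 | ⟨h3, h4, h5⟩
  · exact h3
  · omega
  · exfalso
    have : (att G O Y).Nonempty := by
      rw [← Set.ncard_pos]; omega
    obtain ⟨o, ho⟩ := this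
    refine h.not_unique (hYX hy) (hYy ▸ ho) fun x hx hxo => ?_
    by_contra hxy
    refine Set.disjoint_left.1 h3 ho ⟨ho.1, x, ⟨hx, ?_⟩, hxo⟩
    rw [hYy]; exact hxy

/-- The contact vertices of a part can be pushed into disjoint components. -/
theorem push_comp [Finite V] {Y M : Set V} (hM : Conn G M)
    (hA : ∀ w ∈ M ∩ bdry G Y, ¬ Conn G (M \ {w})) (n : ℕ) :
    ∀ K w, w ∈ M ∩ bdry G Y → IsComp G (M \ {w}) K → K.ncard ≤ n →
      ∃ w' ∈ M ∩ bdry G Y, ∃ K' ⊆ K, IsComp G (M \ {w'}) K' ∧ ∀ x ∈ K', x ∉ bdry G Y := by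
  induction n with
  | zero =>
    intro K w hw hK hn
    have := (Set.ncard_pos (s := K)).2 hK.2.1.1
    omega
  | succ n ih =>
    intro K w hw hK hn
    by_cases hall : ∀ x ∈ K, x ∉ bdry G Y
    · exact ⟨w, hw, K, subset_rfl, hK, hall⟩
    push Not at hall
    obtain ⟨w', hw'K, hw'⟩ := hall
    have hw'M : w' ∈ M := (hK.1 hw'K).1
    obtain ⟨K', hK', hd⟩ := exists_isComp_disjoint (hA w' ⟨hw'M, hw'⟩) (hM.diff_comp hw.1 hK)
      (fun x hx => ⟨hx.1, fun h => hx.2 (h ▸ hw'K)⟩)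
    have hsub : K' ⊆ K := by
      intro x hx
      by_contra hxK
      exact Set.disjoint_left.1 hd ⟨(hK'.1 hx).1, hxK⟩ hx
    have hlt := Set.ncard_lt_ncard (s := K') (t := K)
      ⟨hsub, fun h => (hK'.1 (h hw'K)).2 rfl⟩
    obtain ⟨w'', hw'', K'', h1, h2⟩ := ih K' w' ⟨hw'M, hw'⟩ hK' (by omega)
    exact ⟨w'', hw'', K'', h1.trans hsub, h2⟩

theorem elim [Finite V] (h : OctaSide G X O) : False := by
  obtain ⟨Y, ⟨hYX, hY, hM, hY2⟩, hmax⟩ := exists_max_set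
    (fun Y => Y ⊆ X ∧ Conn G Y ∧ Conn G (X \ Y) ∧ (att G O Y).ncard ≤ 2) h.exists_small_part
  have hmax' : ∀ Z, Z ⊆ X → Conn G Z → Conn G (X \ Z) → Y.ncard < Z.ncard →
      3 ≤ (att G O Z).ncard := by
    intro Z h1 h2 h3 h4
    by_contra h5
    have := hmax Z ⟨h1, h2, h3, by omega⟩
    omega
  set M := X \ Y with hMdef
  have hXb : X ∩ bdry G Y = M ∩ bdry G Y := by
    ext x
    simp only [hMdef, Set.mem_inter_iff, Set.mem_sdiff, bdry, Set.mem_ofPred_eq]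
    tauto
  have hN2 : 2 ≤ (M ∩ bdry G Y).ncard := by
    have := h.four_le Y hYX hY.1
    rw [hXb] at this
    omega
  have hA : ∀ w ∈ M ∩ bdry G Y, ¬ Conn G (M \ {w}) := by
    intro w hw hc
    have hwY : w ∉ Y := hw.1.2
    obtain ⟨y, hy, hyw⟩ := hw.2.2
    have e1 : X \ (Y ∪ {w}) = M \ {w} := by rw [hMdef, Set.sdiff_sdiff]
    have hZX : Y ∪ {w} ⊆ X := Set.union_subset hYX (by simpa using hw.1.1)
    have hZ : Conn G (Y ∪ {w}) := hY.union (conn_singleton G w) ⟨y, hy, w, rfl, hyw⟩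
    have hcard : (Y ∪ {w}).ncard = Y.ncard + 1 := by
      rw [Set.union_singleton, Set.ncard_insert_of_notMem hwY]
    have h3 := hmax' _ hZX hZ (e1 ▸ hc) (by omega)
    have h6 := h.six_le hZX
    have hs := h.split _ hZX hZ (e1 ▸ hc)
    have hO : att G O Y ∪ att G O {w} ∪ att G O (M \ {w}) = O := by
      rw [← att_union, ← e1, h.att_split hZX]
    have hex : ∃ o ∈ O, o ∉ att G O Y ∧ o ∉ att G O (M \ {w}) := by
      by_contra hno
      push Not at hno
      have h7 : O ⊆ att G O Y ∪ att G O (M \ {w}) := by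
        intro o ho
        by_cases hoY : o ∈ att G O Y
        · exact Or.inl hoY
        · exact Or.inr (hno o ho hoY)
      have h8 := Set.ncard_le_ncard h7
      have h9 := Set.ncard_union_le (att G O Y) (att G O (M \ {w}))
      rw [h.card_eq] at h8
      rw [e1] at hs h6
      omega
    obtain ⟨o, ho, ho1, ho2⟩ := hex
    have how : o ∈ att G O {w} := by
      rw [← hO] at ho
      rcases ho with (ho | ho) | ho
      · exact absurd ho ho1
      · exact ho
      · exact absurd ho ho2
    refine h.not_unique hw.1.1 how fun x hx hxo => ?_
    by_contra hxw
    by_cases hxY : x ∈ Y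
    · exact ho1 ⟨ho, x, hxY, hxo⟩
    · exact ho2 ⟨ho, x, ⟨⟨hx, hxY⟩, hxw⟩, hxo⟩
  obtain ⟨w0, hw0⟩ : (M ∩ bdry G Y).Nonempty := by
    rw [← Set.ncard_pos]; omega
  have hne : ∃ v ∈ M, v ≠ w0 := by
    obtain ⟨a, ha, b, hb, hab⟩ := (Set.one_lt_ncard_iff_nontrivial
      (s := M ∩ bdry G Y)).1 (by omega)
    by_cases haw : a = w0
    · exact ⟨b, hb.1, fun h => hab (haw.trans h.symm)⟩
    · exact ⟨a, ha.1, haw⟩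
  obtain ⟨v, hv, hvw⟩ := hne
  obtain ⟨C1, hC1, -⟩ := exists_isComp (G := G) (S := M \ {w0}) ⟨hv, hvw⟩
  obtain ⟨C2, hC2, hd⟩ := exists_isComp_disjoint (hA w0 hw0) hC1.2.1 hC1.1
  obtain ⟨w1, hw1, K1, hs1, hK1, hb1⟩ := push_comp hM hA _ C1 w0 hw0 hC1 le_rfl
  obtain ⟨w2, hw2, K2, hs2, hK2, hb2⟩ := push_comp hM hA _ C2 w0 hw0 hC2 le_rfl
  have hdK : Disjoint K1 K2 := hd.mono hs1 hs2
  have key : ∀ w K, w ∈ M ∩ bdry G Y → IsComp G (M \ {w}) K → (∀ x ∈ K, x ∉ bdry G Y) →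
      K ⊆ X ∧ X ∩ bdry G K ⊆ {w} ∧ Disjoint (att G O K) (att G O (X \ K)) ∧
        (att G O K).ncard = 3 ∧ (att G O (X \ K)).ncard = 3 := by
    intro w K hw hK hb
    have hKX : K ⊆ X := fun x hx => (hK.1 hx).1.1
    have hKY : ∀ x ∈ K, x ∉ Y := fun x hx => (hK.1 hx).1.2
    have hwK : w ∉ K := fun h => (hK.1 h).2 rfl
    have hbd : X ∩ bdry G K ⊆ {w} := by
      rintro b ⟨hbX, hbK, a, ha, hab⟩
      by_cases hbY : b ∈ Y
      · exact absurd ⟨hKY a ha, b, hbY, hab.symm⟩ (hb a ha)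
      · by_contra hbw
        exact hbK (hK.2.2 a ha b ⟨⟨hbX, hbY⟩, hbw⟩ hab)
    have h3 := h.three_le_att_of_isComp hK.2.1 hKX hbd
    obtain ⟨y, hy, hyw⟩ := hw.2.2
    have hc : Conn G (X \ K) := by
      have h2 := hY.union (hM.diff_comp hw.1 hK) ⟨y, hy, w, ⟨hw.1, hwK⟩, hyw⟩
      convert h2 using 1
      ext x
      have := @hYX x
      have := hKY x
      simp only [hMdef, Set.mem_union, Set.mem_sdiff]
      tauto
    have hlt : Y.ncard < (X \ K).ncard := by
      refine Set.ncard_lt_ncard ⟨fun x hx => ⟨hYX hx, fun hxK => hKY x hxK hx⟩, fun h => ?_⟩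
      exact hw.1.2 (h ⟨hw.1.1, hwK⟩)
    have h4 := hmax' _ Set.sdiff_subset hc (by
      rw [Set.sdiff_sdiff_cancel_left hKX]; exact hK.2.1) hlt
    rcases h.split K hKX hK.2.1 hc with h5 | h5 | h5
    · omega
    · omega
    · exact ⟨hKX, hbd, h5⟩
  obtain ⟨hX1, hB1, hD1, hE1, hF1⟩ := key w1 K1 hw1 hK1 hb1
  obtain ⟨hX2, hB2, hD2, hE2, hF2⟩ := key w2 K2 hw2 hK2 hb2
  have heq : att G O K2 = att G O (X \ K1) := by
    refine Set.eq_of_subset_of_ncard_le (att_mono fun x hx => ⟨hX2 hx, fun hx1 =>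
      Set.disjoint_left.1 hdK hx1 hx⟩) (by omega)
  have hfin := h.four_le ((X \ (K1 ∪ K2)) \ {w1, w2}) (fun x hx => hx.1.1) (by
    obtain ⟨y, hy⟩ := hY.1
    refine ⟨y, ⟨hYX hy, ?_⟩, ?_⟩
    · rintro (h | h)
      · exact (hK1.1 h).1.2 hy
      · exact (hK2.1 h).1.2 hy
    · rintro (h | h)
      · exact hw1.1.2 (h ▸ hy)
      · exact hw2.1.2 (h ▸ hy))
  have hz : att G O ((X \ (K1 ∪ K2)) \ {w1, w2}) = ∅ := by
    refine Set.eq_empty_of_forall_notMem fun o ho => ?_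
    have h1 : o ∈ att G O (X \ K1) :=
      att_mono (Z := X \ K1)
        (fun x hx => ⟨hx.1.1, fun h => hx.1.2 (Or.inl h)⟩) ho
    have h2 : o ∈ att G O (X \ K2) :=
      att_mono (Z := X \ K2)
        (fun x hx => ⟨hx.1.1, fun h => hx.1.2 (Or.inr h)⟩) ho
    exact Set.disjoint_left.1 hD2 (heq ▸ h1) h2
  have hbL : X ∩ bdry G ((X \ (K1 ∪ K2)) \ {w1, w2}) ⊆ {w1, w2} := by
    rintro b ⟨hbX, hbL, a, ha, hab⟩
    by_contra hbw
    have hbK : b ∈ K1 ∪ K2 := by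
      by_contra hbK
      exact hbL ⟨⟨hbX, hbK⟩, hbw⟩
    rcases hbK with hbK | hbK
    · exact ha.2 (Or.inl (hB1 ⟨ha.1.1, fun h => ha.1.2 (Or.inl h), b, hbK, hab.symm⟩))
    · exact ha.2 (Or.inr (hB2 ⟨ha.1.1, fun h => ha.1.2 (Or.inr h), b, hbK, hab.symm⟩))
  have h1 := Set.ncard_le_ncard hbL
  have h2 := Set.ncard_insert_le w1 {w2}
  rw [Set.ncard_singleton] at h2
  rw [hz, Set.ncard_empty] at hfin
  omega

end OctaSide

end Attach

section Counting

variable {V W : Type} {G : SimpleGraph V}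

/-- Twice the number of edges of `G` inside `S`. -/
noncomputable def adjCount (G : SimpleGraph V) (S : Set V) : ℕ :=
  {p : V × V | p.1 ∈ S ∧ p.2 ∈ S ∧ G.Adj p.1 p.2}.ncard

theorem adjCount_empty : adjCount G ∅ = 0 := by
  simp [adjCount]

theorem adjCount_insert [Finite V] {S : Set V} {v : V} (hv : v ∉ S) :
    adjCount G (insert v S) = adjCount G S + 2 * (G.neighborSet v ∩ S).ncard := by
  have e : {p : V × V | p.1 ∈ insert v S ∧ p.2 ∈ insert v S ∧ G.Adj p.1 p.2} =
      {p : V × V | p.1 ∈ S ∧ p.2 ∈ S ∧ G.Adj p.1 p.2} ∪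
        (Prod.mk v '' (G.neighborSet v ∩ S) ∪ (fun x => (x, v)) '' (G.neighborSet v ∩ S)) := by
    ext ⟨x, y⟩
    simp only [Set.mem_ofPred_eq, Set.mem_insert_iff, Set.mem_union, Set.mem_image,
      Set.mem_inter_iff, SimpleGraph.mem_neighborSet, Prod.mk.injEq]
    constructor
    · rintro ⟨rfl | hx, rfl | hy, hxy⟩
      · exact absurd hxy (G.irrefl)
      · exact Or.inr (Or.inl ⟨y, ⟨hxy, hy⟩, rfl, rfl⟩)
      · exact Or.inr (Or.inr ⟨x, ⟨hxy.symm, hx⟩, rfl, rfl⟩)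
      · exact Or.inl ⟨hx, hy, hxy⟩
    · rintro (⟨hx, hy, hxy⟩ | ⟨z, ⟨h1, h2⟩, rfl, rfl⟩ | ⟨z, ⟨h1, h2⟩, rfl, rfl⟩)
      · exact ⟨Or.inr hx, Or.inr hy, hxy⟩
      · exact ⟨Or.inl rfl, Or.inr h2, h1⟩
      · exact ⟨Or.inr h2, Or.inl rfl, h1.symm⟩
  rw [adjCount, e, Set.ncard_union_eq, Set.ncard_union_eq, Set.ncard_image_of_injective,
    Set.ncard_image_of_injective, adjCount]
  · omega
  · exact fun x y h => (Prod.mk.inj h).1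
  · exact fun x y h => (Prod.mk.inj h).2
  · rw [Set.disjoint_left]
    rintro _ ⟨x, hx, rfl⟩ ⟨y, hy, h⟩
    obtain ⟨rfl, -⟩ := Prod.mk.inj h
    exact hv hy.2
  · rw [Set.disjoint_left]
    rintro ⟨x, y⟩ ⟨h1, h2, -⟩ (⟨z, hz, h⟩ | ⟨z, hz, h⟩)
    · obtain ⟨rfl, -⟩ := Prod.mk.inj h
      exact hv h1
    · obtain ⟨-, rfl⟩ := Prod.mk.inj h
      exact hv h2

theorem even_adjCount [Finite V] (S : Set V) : Even (adjCount G S) := by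
  induction S, S.toFinite using Set.Finite.induction_on with
  | empty => simp [adjCount_empty]
  | insert hv _ ih =>
    rw [adjCount_insert hv]
    exact ih.add (even_two_mul _)

theorem adjCount_le [Finite V] (S : Set V) :
    (adjCount G S : ℤ) ≤ S.ncard * (S.ncard - 1) := by
  induction S, S.toFinite using Set.Finite.induction_on with
  | empty => simp [adjCount_empty]
  | @insert v S hv _ ih =>
    rw [adjCount_insert hv, Set.ncard_insert_of_notMem hv]
    have := Set.ncard_le_ncard (s := G.neighborSet v ∩ S) (t := S) Set.inter_subset_right
    push_cast
    have h2 : ((G.neighborSet v ∩ S).ncard : ℤ) ≤ S.ncard := by exact_mod_cast this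
    linarith

theorem adjCount_image [Finite V] {H : SimpleGraph W} {f : V → W} (hf : f.Injective)
    {S : Set V} (h : ∀ x ∈ S, ∀ y ∈ S, H.Adj (f x) (f y) ↔ G.Adj x y) :
    adjCount H (f '' S) = adjCount G S := by
  rw [adjCount, adjCount, ← Set.ncard_image_of_injective _ (hf.prodMap hf)]
  congr 1
  ext ⟨x, y⟩
  constructor
  · rintro ⟨⟨a, ha, rfl⟩, ⟨b, hb, rfl⟩, hab⟩
    exact ⟨(a, b), ⟨ha, hb, (h a ha b hb).1 hab⟩, rfl⟩
  · rintro ⟨⟨a, b⟩, ⟨ha, hb, hab⟩, h'⟩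
    obtain ⟨rfl, rfl⟩ := Prod.mk.inj h'
    exact ⟨⟨a, ha, rfl⟩, ⟨b, hb, rfl⟩, (h a ha b hb).2 hab⟩

theorem adjCount_univ [Finite V] (G : SimpleGraph V) :
    adjCount G Set.univ = 2 * G.edgeSet.ncard := by
  classical
  have := Fintype.ofFinite V
  rw [← SimpleGraph.coe_edgeFinset, Set.ncard_coe_finset, ← G.dart_card_eq_twice_card_edges,
    ← Nat.card_eq_fintype_card, adjCount, ← Nat.card_coe_set_eq]
  refine (Nat.card_congr ⟨fun d => ⟨d.toProd, trivial, trivial, d.adj⟩,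
    fun p => ⟨p.1, p.2.2.2⟩, fun d => rfl, fun p => rfl⟩).symm

/-- For separated `D`, `E`, the edges inside `P ∪ D ∪ E` are those inside `P ∪ D` and those inside
`P ∪ E`. -/
theorem adjCount_add_adjCount [Finite V] {P D E : Set V} (hDE : Disjoint D E)
    (hno : ∀ d ∈ D, ∀ e ∈ E, ¬ G.Adj d e) :
    adjCount G (P ∪ D) + adjCount G (P ∪ E) = adjCount G (P ∪ D ∪ E) + adjCount G P := by
  unfold adjCount
  rw [← Set.ncard_union_add_ncard_inter]
  congr 2
  · ext ⟨x, y⟩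
    have h1 := hno x
    have h2 := fun hy hx (h : G.Adj x y) => hno y hy x hx h.symm
    simp only [Set.mem_union, Set.mem_ofPred_eq]
    grind
  · ext ⟨x, y⟩
    have h1 : x ∈ D → x ∉ E := fun h => Set.disjoint_left.1 hDE h
    have h2 : y ∈ D → y ∉ E := fun h => Set.disjoint_left.1 hDE h
    simp only [Set.mem_union, Set.mem_inter_iff, Set.mem_ofPred_eq]
    tauto

/-- Twice the excess of the number of edges over `4 n - 8`. -/
noncomputable def excess (G : SimpleGraph V) : ℤ :=
  adjCount G Set.univ - 8 * Nat.card V + 16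

theorem seven_le_of_excess_nonneg [Finite V] (h : 0 ≤ excess G) (h3 : 3 ≤ Nat.card V) :
    7 ≤ Nat.card V := by
  have h1 := adjCount_le (G := G) Set.univ
  rw [Set.ncard_univ] at h1
  unfold excess at h
  by_contra hlt
  have : Nat.card V ≤ 6 := by omega
  generalize Nat.card V = n at *
  interval_cases n <;> norm_num at * <;> omega

theorem MinorMinimalEnemy.nonempty_iso [Fintype V] [Finite W] (h : MinorMinimalEnemy G)
    {H : SimpleGraph W} (hm : IsMinor H G) (hlt : Nat.card W < Nat.card V) (h3 : 3 ≤ Nat.card W)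
    (hb : Bdry4 H) (he : 0 ≤ excess H) : Nonempty (K2222 ≃g H) := by
  have := Fintype.ofFinite W
  have h7 := seven_le_of_excess_nonneg he h3
  by_contra hno
  have hE : Enemy H := by
    refine ⟨isKConnected_of_bdry4 hb (by rw [← Nat.card_eq_fintype_card]; omega), ?_,
      fun hK => h.1.2.2.1 (hK.trans hm), ⟨fun e => hno ⟨e.symm⟩⟩⟩
    rw [excess, adjCount_univ] at he
    rw [← Nat.card_eq_fintype_card]
    push_cast at he
    omega
  obtain ⟨e⟩ := h.2 W H hm hE
  have := Nat.card_congr e.toEquiv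
  omega

theorem MinorMinimalEnemy.bdry4 [Fintype V] (h : MinorMinimalEnemy G) : Bdry4 G :=
  bdry4_of_isKConnected h.1.1

theorem MinorMinimalEnemy.excess_nonneg [Fintype V] (h : MinorMinimalEnemy G) : 0 ≤ excess G := by
  have := h.1.2.1
  rw [excess, adjCount_univ, Nat.card_eq_fintype_card]
  push_cast
  omega

theorem MinorMinimalEnemy.five_le_card [Fintype V] (h : MinorMinimalEnemy G) :
    5 ≤ Nat.card V := by
  rw [Nat.card_eq_fintype_card]
  exact h.1.1.1

theorem excess_iso [Finite V] [Finite W] {H : SimpleGraph W} (e : G ≃g H) :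
    excess G = excess H := by
  unfold excess
  rw [Nat.card_congr e.toEquiv, ← adjCount_image (H := H) (f := e) e.injective
    (fun x _ y _ => e.map_adj_iff), Set.image_univ, e.surjective.range_eq]

theorem excess_K2222 : excess K2222 = 0 := by
  have h1 : adjCount K2222 Set.univ = 48 := by
    have e : {p : (Fin 4 × Fin 2) × (Fin 4 × Fin 2) | p.1 ∈ Set.univ ∧ p.2 ∈ Set.univ ∧
        K2222.Adj p.1 p.2} = ↑({p | p.1.1 ≠ p.2.1} :
          Finset ((Fin 4 × Fin 2) × (Fin 4 × Fin 2))) := by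
      ext p
      simp [K2222]
    rw [adjCount, e, Set.ncard_coe_finset]
    decide +kernel
  rw [excess, h1, Nat.card_prod, Nat.card_fin, Nat.card_fin]
  norm_num

end Counting

section Contract

variable {V : Type} {G : SimpleGraph V}

/-- The graph obtained from `G` by identifying all vertices of `X` to the single vertex `none`. -/
def contr (G : SimpleGraph V) (X : Set V) : SimpleGraph (Option {v // v ∉ X}) where
  Adj
    | none, none => False
    | none, some v => ∃ x ∈ X, G.Adj x v
    | some v, none => ∃ x ∈ X, G.Adj x v
    | some u, some v => G.Adj u v
  symm := ⟨by
    rintro (_ | u) (_ | v) h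
    · exact h
    · exact h
    · exact h
    · exact G.symm.symm _ _ h⟩
  loopless := ⟨by
    rintro (_ | u) h
    · exact h
    · exact G.loopless.irrefl _ h⟩

variable {X : Set V}

@[simp] theorem contr_some_some (u v : {v // v ∉ X}) :
    (contr G X).Adj (some u) (some v) ↔ G.Adj u v := Iff.rfl

@[simp] theorem contr_none_some (v : {v // v ∉ X}) :
    (contr G X).Adj none (some v) ↔ (v : V) ∈ bdry G X :=
  ⟨fun h => ⟨v.2, h⟩, fun h => h.2⟩

@[simp] theorem contr_some_none (v : {v // v ∉ X}) :
    (contr G X).Adj (some v) none ↔ (v : V) ∈ bdry G X :=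
  ⟨fun h => ⟨v.2, h⟩, fun h => h.2⟩

theorem isMinor_contr (hX : Conn G X) : IsMinor (contr G X) G := by
  refine ⟨fun w => w.elim X fun v => {(v : V)}, ?_, ?_, ?_⟩
  · rintro (_ | v)
    · exact (conn_iff _ _).2 hX
    · exact (conn_iff _ _).2 (conn_singleton G _)
  · rintro (_ | u) (_ | v) h
    · exact absurd rfl h
    · exact Set.disjoint_singleton_right.2 v.2
    · exact Set.disjoint_singleton_left.2 u.2
    · exact Set.disjoint_singleton.2 fun e => h (congrArg some (Subtype.ext e))
  · rintro (_ | u) (_ | v) h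
    · exact absurd h (SimpleGraph.irrefl _)
    · obtain ⟨x, hx, hxv⟩ := h
      exact ⟨x, hx, v, rfl, hxv⟩
    · obtain ⟨x, hx, hxv⟩ := h
      exact ⟨u, rfl, x, hx, hxv.symm⟩
    · exact ⟨u, rfl, v, rfl, h⟩

theorem card_contr [Finite V] (X : Set V) : Nat.card (Option {v // v ∉ X}) = Xᶜ.ncard + 1 := by
  rw [Finite.card_option]
  rfl

/-- Twice the excess of `contr G X`, computed in `G`. -/
noncomputable def rho (G : SimpleGraph V) (X : Set V) : ℤ :=
  adjCount G Xᶜ + 2 * (bdry G X).ncard - 8 * Xᶜ.ncard + 8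

theorem even_rho [Finite V] (X : Set V) : Even (rho G X) := by
  obtain ⟨k, hk⟩ := even_adjCount (G := G) Xᶜ
  exact ⟨k + (bdry G X).ncard - 4 * Xᶜ.ncard + 4, by rw [rho, hk]; push_cast; ring⟩

theorem image_some_preimage (S : Set V) (hS : ∀ v ∈ S, v ∉ X) :
    Subtype.val '' {v : {v // v ∉ X} | (v : V) ∈ S} = S := by
  ext v
  constructor
  · rintro ⟨w, hw, rfl⟩
    exact hw
  · exact fun h => ⟨⟨v, hS v h⟩, h, rfl⟩

theorem excess_contr [Finite V] (X : Set V) : excess (contr G X) = rho G X := by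
  have h1 : adjCount (contr G X) (Set.range some) = adjCount G Xᶜ := by
    rw [← Set.image_univ, adjCount_image (G := G.induce Xᶜ) (Option.some_injective _)
      (fun x _ y _ => Iff.rfl), ← adjCount_image (H := G) Subtype.val_injective
      (fun x _ y _ => Iff.rfl), Set.image_univ, Subtype.range_coe]
  have h2 : (contr G X).neighborSet none ∩ Set.range some =
      some '' {v : {v // v ∉ X} | (v : V) ∈ bdry G X} := by
    ext (_ | v)
    · simp
    · simp
  have h3 : insert none (Set.range some) = (Set.univ : Set (Option {v // v ∉ X})) := by
    ext (_ | v) <;> simp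
  rw [excess, card_contr, ← h3, adjCount_insert (by simp), h1, h2,
    Set.ncard_image_of_injective _ (Option.some_injective _),
    ← Set.ncard_image_of_injective _ Subtype.val_injective,
    image_some_preimage _ (fun v hv => hv.1), rho]
  push_cast
  ring

theorem MinorMinimalEnemy.iso_contr [Fintype V] (h : MinorMinimalEnemy G) (hX : Conn G X)
    (h2 : 2 ≤ X.ncard) (hc : 2 ≤ Xᶜ.ncard) (hr : 0 ≤ rho G X) (hb : Bdry4 (contr G X)) :
    Nonempty (K2222 ≃g contr G X) := by
  have := Set.ncard_add_ncard_compl X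
  refine h.nonempty_iso (isMinor_contr hX) ?_ ?_ hb (by rwa [excess_contr])
  · rw [card_contr]; omega
  · rw [card_contr]; omega

theorem rho_pair [Finite V] {u v : V} (huv : G.Adj u v) :
    rho G {u, v} = excess G + 6 - 2 * (G.neighborSet u ∩ G.neighborSet v).ncard := by
  have hne := huv.ne
  have e1 : ({u, v} : Set V)ᶜ ∪ {v} = {u}ᶜ := by
    ext x
    by_cases hx : x = v
    · subst hx; simp [hne.symm]
    · simp [hx]
  have h1 : adjCount G Set.univ =
      adjCount G {u}ᶜ + 2 * (G.neighborSet u ∩ {u}ᶜ).ncard := by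
    rw [← adjCount_insert (by simp)]
    congr 1
    ext x
    simp [em]
  have h2 : adjCount G {u}ᶜ =
      adjCount G {u, v}ᶜ + 2 * (G.neighborSet v ∩ {u, v}ᶜ).ncard := by
    rw [← adjCount_insert (by simp), ← e1, Set.union_singleton]
  have h3 : (G.neighborSet u ∩ {u}ᶜ) = insert v (G.neighborSet u ∩ {u, v}ᶜ) := by
    ext x
    have := @huv
    have := G.irrefl (v := u)
    simp only [Set.mem_inter_iff, SimpleGraph.mem_neighborSet, Set.mem_compl_iff,
      Set.mem_singleton_iff, Set.mem_insert_iff]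
    grind
  have h4 : bdry G {u, v} = (G.neighborSet u ∩ {u, v}ᶜ) ∪ (G.neighborSet v ∩ {u, v}ᶜ) := by
    ext x
    simp only [bdry, Set.mem_ofPred_eq, Set.mem_inter_iff, SimpleGraph.mem_neighborSet,
      Set.mem_compl_iff, Set.mem_singleton_iff, Set.mem_insert_iff, Set.mem_union]
    grind
  have h5 : (G.neighborSet u ∩ {u, v}ᶜ) ∩ (G.neighborSet v ∩ {u, v}ᶜ) =
      G.neighborSet u ∩ G.neighborSet v := by
    ext x
    have := G.irrefl (v := u)
    have := G.irrefl (v := v)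
    simp only [Set.mem_inter_iff, SimpleGraph.mem_neighborSet, Set.mem_compl_iff,
      Set.mem_singleton_iff, Set.mem_insert_iff]
    grind
  have h6 := Set.ncard_union_add_ncard_inter (G.neighborSet u ∩ {u, v}ᶜ)
    (G.neighborSet v ∩ {u, v}ᶜ)
  rw [← h4, h5] at h6
  have h7 : (G.neighborSet u ∩ {u}ᶜ).ncard = (G.neighborSet u ∩ {u, v}ᶜ).ncard + 1 := by
    rw [h3, Set.ncard_insert_of_notMem (by simp)]
  have h8 := Set.ncard_add_ncard_compl ({u, v} : Set V)
  rw [Set.ncard_pair hne] at h8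
  rw [rho, excess]
  omega

theorem conn_pair {u v : V} (huv : G.Adj u v) : Conn G {u, v} :=
  (conn_singleton G u).union (conn_singleton G v) ⟨u, rfl, v, rfl, huv⟩

/-- `P` separates `D` from `E` in `G - X`. -/
structure IsSep (G : SimpleGraph V) (X P D E : Set V) : Prop where
  union_eq : P ∪ D ∪ E = Xᶜ
  disj_left : Disjoint P D
  disj_right : Disjoint P E
  disj : Disjoint D E
  left_nonempty : D.Nonempty
  right_nonempty : E.Nonempty
  not_adj : ∀ d ∈ D, ∀ e ∈ E, ¬ G.Adj d e

theorem IsSep.symm {P D E : Set V} (h : IsSep G X P D E) : IsSep G X P E D where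
  union_eq := by rw [← h.union_eq, Set.union_right_comm]
  disj_left := h.disj_right
  disj_right := h.disj_left
  disj := h.disj.symm
  left_nonempty := h.right_nonempty
  right_nonempty := h.left_nonempty
  not_adj := fun d hd e he hde => h.not_adj e he d hd hde.symm

theorem exists_isSep [Finite V] (hG : Bdry4 G) (hX : X.Nonempty)
    {H : SimpleGraph (Option {v // v ∉ X})} (hH : contr G X ≤ H) (h : ¬ Bdry4 H) :
    ∃ P D E, IsSep G X P D E ∧ P.ncard ≤ 2 ∧
      ∀ d e : {v // v ∉ X}, (d : V) ∈ D → (e : V) ∈ E → ¬ H.Adj (some d) (some e) := by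
  unfold Bdry4 at h
  push Not at h
  obtain ⟨A, hA, ⟨b, hbA, hbb⟩, hlt⟩ := h
  set B : Set (Option {v // v ∉ X}) := {x | x ∉ A ∧ x ∉ bdry H A} with hB
  let re : Set (Option {v // v ∉ X}) → Set V := fun S => {v | ∃ hv : v ∉ X, some ⟨v, hv⟩ ∈ S}
  have hre : ∀ S : Set (Option {v // v ∉ X}), (re S).ncard ≤ S.ncard := by
    intro S
    have : some '' {v : {v // v ∉ X} | some v ∈ S} ⊆ S := by
      rintro _ ⟨v, hv, rfl⟩
      exact hv
    refine le_trans ?_ (Set.ncard_le_ncard this)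
    rw [Set.ncard_image_of_injective _ (Option.some_injective _)]
    have e : re S = Subtype.val '' {v : {v // v ∉ X} | some v ∈ S} := by
      ext v
      simp [re]
    rw [e]
    exact Set.ncard_image_le
  have hAB : ∀ x ∈ A, ∀ y ∈ B, ¬ H.Adj x y := fun x hx y hy hxy => hy.2 ⟨hy.1, x, hx, hxy⟩
  have hreal : ∀ S T : Set (Option {v // v ∉ X}), (∀ x ∈ S, ∀ y ∈ T, ¬ H.Adj x y) →
      (∀ x, x ∈ S ∨ x ∈ T ∨ x ∈ bdry H A) → none ∈ T → S.Nonempty → none ∉ S → False := by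
    intro S T hST hall hT hS hnS
    obtain ⟨s, hs⟩ := hS
    have hsub : bdry G (re S) ⊆ re (bdry H A) := by
      rintro v ⟨hv, a, ⟨haX, haS⟩, hav⟩
      have hvX : v ∉ X := by
        intro hvX
        refine hST _ haS _ hT (hH ?_)
        rw [contr_some_none]
        exact ⟨haX, v, hvX, hav.symm⟩
      refine ⟨hvX, ?_⟩
      rcases hall (some ⟨v, hvX⟩) with h1 | h1 | h1
      · exact absurd ⟨hvX, h1⟩ hv
      · exact absurd (hH ((contr_some_some ⟨a, haX⟩ ⟨v, hvX⟩).2 hav)) (hST _ haS _ h1)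
      · exact h1
    obtain ⟨x, hx⟩ := hX
    have h4 := hG (re S) (by
      rcases s with _ | s
      · exact absurd hs hnS
      · exact ⟨s, s.2, hs⟩) ⟨x, fun h => h.1 hx, fun h => (hsub h).1 hx⟩
    have := Set.ncard_le_ncard hsub
    have := hre (bdry H A)
    omega
  have hnA : none ∉ A := by
    intro hn
    refine hreal B A (fun x hx y hy h => hAB y hy x hx h.symm) (fun x => ?_) hn ⟨b, hbA, hbb⟩
      (fun h => h.1 hn)
    rw [hB, Set.mem_ofPred_eq]
    tauto
  have hnB : none ∉ B := by
    intro hn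
    refine hreal A B hAB (fun x => ?_) hn hA hnA
    rw [hB, Set.mem_ofPred_eq]
    tauto
  have hnP : none ∈ bdry H A := by
    by_contra hn
    exact hnB ⟨hnA, hn⟩
  refine ⟨re (bdry H A), re A, re B, ⟨?_, ?_, ?_, ?_, ?_, ?_, ?_⟩, ?_, ?_⟩
  · ext v
    simp only [re, Set.mem_union, Set.mem_ofPred_eq, Set.mem_compl_iff, hB]
    constructor
    · rintro ((⟨h, -⟩ | ⟨h, -⟩) | ⟨h, -⟩) <;> exact h
    · intro h
      by_cases h1 : some ⟨v, h⟩ ∈ A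
      · exact Or.inl (Or.inr ⟨h, h1⟩)
      by_cases h2 : some ⟨v, h⟩ ∈ bdry H A
      · exact Or.inl (Or.inl ⟨h, h2⟩)
      · exact Or.inr ⟨h, h1, h2⟩
  · rw [Set.disjoint_left]
    rintro v ⟨h, h1⟩ ⟨_, h2⟩
    exact h1.1 h2
  · rw [Set.disjoint_left]
    rintro v ⟨h, h1⟩ ⟨_, h2⟩
    exact h2.2 h1
  · rw [Set.disjoint_left]
    rintro v ⟨h, h1⟩ ⟨_, h2⟩
    exact h2.1 h1
  · obtain ⟨_ | a, ha⟩ := hA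
    · exact absurd ha hnA
    · exact ⟨a, a.2, ha⟩
  · rcases b with _ | b
    · exact absurd ⟨hbA, hbb⟩ hnB
    · exact ⟨b, b.2, hbA, hbb⟩
  · rintro d ⟨hd, hd'⟩ e ⟨he, he'⟩ hde
    exact hAB _ hd' _ he' (hH hde)
  · have h1 : re (bdry H A) = re (bdry H A \ {none}) := by
      ext v
      simp [re]
    have h2 := hre (bdry H A \ {none})
    rw [← h1, Set.ncard_sdiff_singleton_of_mem hnP] at h2
    omega
  · rintro d e ⟨_, hd⟩ ⟨_, he⟩
    exact hAB _ hd _ he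

end Contract

section Wheel

variable {V : Type} {G : SimpleGraph V}

/-- The vertices `h, q, q', a, a'` span a wheel with hub `h` and rim `q a q' a'`. -/
structure IsWheel (G : SimpleGraph V) (h q q' a a' : V) : Prop where
  hq : G.Adj h q
  hq' : G.Adj h q'
  ha : G.Adj h a
  ha' : G.Adj h a'
  qa : G.Adj q a
  qa' : G.Adj q a'
  q'a : G.Adj q' a
  q'a' : G.Adj q' a'
  q_ne : q ≠ q'
  a_ne : a ≠ a'

/-- A separator of size at most two cannot split a wheel. -/
theorem IsWheel.not_split [Finite V] {h q q' a a' : V} (hw : IsWheel G h q q' a a')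
    {X P D E : Set V} (hs : IsSep G X P D E) (hP : P.ncard ≤ 2)
    (hX : ∀ x ∈ ({h, q, q', a, a'} : Set V), x ∉ X) :
    (∀ x ∈ ({h, q, q', a, a'} : Set V), x ∉ D) ∨ ∀ x ∈ ({h, q, q', a, a'} : Set V), x ∉ E := by
  have hmem : ∀ x, x ∉ X → x ∈ P ∨ x ∈ D ∨ x ∈ E := by
    intro x hx
    have : x ∈ P ∪ D ∪ E := by rw [hs.union_eq]; exact hx
    rcases this with (h1 | h1) | h1 <;> tauto
  have h3 : ∀ x y z : V, x ≠ y → x ≠ z → y ≠ z → x ∈ P → y ∈ P → z ∈ P → False := by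
    intro x y z hxy hxz hyz hx hy hz
    have h1 : ({x, y, z} : Set V) ⊆ P := by
      rintro w (rfl | rfl | rfl) <;> assumption
    have h2 := Set.ncard_le_ncard h1
    rw [Set.ncard_eq_three.2 ⟨x, y, z, hxy, hxz, hyz, rfl⟩] at h2
    omega
  have hno : ∀ x y, G.Adj x y → x ∈ D → y ∈ E → False := fun x y hxy hx hy =>
    hs.not_adj x hx y hy hxy
  have hno' : ∀ x y, G.Adj x y → x ∈ E → y ∈ D → False := fun x y hxy hx hy =>
    hs.not_adj y hy x hx hxy.symm
  have d1 : ∀ x, x ∈ D → x ∉ E := fun x hx => Set.disjoint_left.1 hs.disj hx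
  have d2 : ∀ x, x ∈ P → x ∉ D := fun x hx => Set.disjoint_left.1 hs.disj_left hx
  have d3 : ∀ x, x ∈ P → x ∉ E := fun x hx => Set.disjoint_left.1 hs.disj_right hx
  simp only [Set.mem_insert_iff, Set.mem_singleton_iff, forall_eq_or_imp, forall_eq] at hX ⊢
  obtain ⟨x1, x2, x3, x4, x5⟩ := hX
  have m1 := hmem _ x1
  have m2 := hmem _ x2
  have m3 := hmem _ x3
  have m4 := hmem _ x4
  have m5 := hmem _ x5
  have n1 := h3 h q q' hw.hq.ne hw.hq'.ne hw.q_ne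
  have n2 := h3 h a a' hw.ha.ne hw.ha'.ne hw.a_ne
  have a1 := hno _ _ hw.hq
  have a2 := hno _ _ hw.hq'
  have a3 := hno _ _ hw.ha
  have a4 := hno _ _ hw.ha'
  have a5 := hno _ _ hw.qa
  have a6 := hno _ _ hw.qa'
  have a7 := hno _ _ hw.q'a
  have a8 := hno _ _ hw.q'a'
  have b1 := hno' _ _ hw.hq
  have b2 := hno' _ _ hw.hq'
  have b3 := hno' _ _ hw.ha
  have b4 := hno' _ _ hw.ha'
  have b5 := hno' _ _ hw.qa
  have b6 := hno' _ _ hw.qa'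
  have b7 := hno' _ _ hw.q'a
  have b8 := hno' _ _ hw.q'a'
  have e1 := d1 h; have e2 := d1 q; have e3 := d1 q'; have e4 := d1 a; have e5 := d1 a'
  have f1 := d2 h; have f2 := d2 q; have f3 := d2 q'; have f4 := d2 a; have f5 := d2 a'
  have g1 := d3 h; have g2 := d3 q; have g3 := d3 q'; have g4 := d3 a; have g5 := d3 a'
  clear hno hno' d1 d2 d3 hmem h3
  grind

/-- Contracting an edge `ow` preserves `4`-connectivity when the other neighbours of `o` lie on a
wheel. -/
theorem bdry4_contr_of_wheel [Finite V] (hG : Bdry4 G) {h q q' a a' o w : V}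
    (hw : IsWheel G h q q' a a') (hX : ∀ x ∈ ({h, q, q', a, a'} : Set V), x ∉ ({o, w} : Set V))
    (ho : ∀ x, G.Adj o x → x = w ∨ x ∈ ({h, q, q', a, a'} : Set V)) :
    Bdry4 (contr G {o, w}) := by
  by_contra hb
  obtain ⟨P, D, E, hs, hP, -⟩ := exists_isSep hG ⟨o, Or.inl rfl⟩ le_rfl hb
  have key : ∀ D E, IsSep G {o, w} P D E → (∀ x ∈ ({h, q, q', a, a'} : Set V), x ∉ D) → False := by
    intro D E hs hD
    have hnD : ∀ d ∈ D, d ≠ o ∧ d ≠ w := by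
      intro d hd
      have : d ∈ ({o, w} : Set V)ᶜ := by rw [← hs.union_eq]; exact Or.inl (Or.inr hd)
      simpa using this
    have hsub : bdry G D ⊆ insert w P := by
      rintro b ⟨hb, d, hd, hdb⟩
      by_contra hbP
      have hbw : b ≠ w := fun h => hbP (Or.inl h)
      have hbo : b ≠ o := by
        rintro rfl
        exact (ho d hdb.symm).elim (hnD d hd).2 fun h => hD d h hd
      have : b ∈ P ∪ D ∪ E := by rw [hs.union_eq]; simp [hbw, hbo]
      rcases this with (h1 | h1) | h1
      · exact hbP (Or.inr h1)
      · exact hb h1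
      · exact hs.not_adj d hd b h1 hdb
    obtain ⟨e, he⟩ := hs.right_nonempty
    have h4 := hG D hs.left_nonempty ⟨e, fun h => Set.disjoint_left.1 hs.disj h he,
      fun h => h.2.elim fun d hd => hs.not_adj d hd.1 e he hd.2⟩
    have := Set.ncard_le_ncard hsub
    have := Set.ncard_insert_le w P
    omega
  rcases hw.not_split hs hP hX with h1 | h1
  · exact key D E hs h1
  · exact key E D hs.symm h1

end Wheel

section Octahedron

variable {W : Type}

theorem K2222_adj (s t : Fin 4 × Fin 2) : K2222.Adj s t ↔ s.1 ≠ t.1 := by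
  simp [K2222]

/-- `K2222` has an automorphism taking any triangle to the standard one. -/
theorem exists_iso_triangle {H : SimpleGraph W} (φ : K2222 ≃g H) {x p q : W} (hxp : H.Adj x p)
    (hxq : H.Adj x q) (hpq : H.Adj p q) :
    ∃ ψ : K2222 ≃g H, ψ (0, 0) = x ∧ ψ (1, 0) = p ∧ ψ (2, 0) = q := by
  obtain ⟨⟨i, i'⟩, rfl⟩ := φ.surjective x
  obtain ⟨⟨j, j'⟩, rfl⟩ := φ.surjective p
  obtain ⟨⟨k, k'⟩, rfl⟩ := φ.surjective q
  rw [φ.map_adj_iff, K2222_adj] at hxp hxq hpq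
  have hσ : ∀ i j k : Fin 4, i ≠ j → i ≠ k → j ≠ k →
      ∃ σ : Equiv.Perm (Fin 4), σ 0 = i ∧ σ 1 = j ∧ σ 2 = k := by
    decide +kernel
  obtain ⟨σ, rfl, rfl, rfl⟩ := hσ i j k hxp hxq hpq
  let e : Fin 4 × Fin 2 ≃ Fin 4 × Fin 2 :=
    (Equiv.prodShear (Equiv.refl _) fun s => Equiv.addLeft (![i', j', k', 0] s)).trans
      (Equiv.prodCongr σ (Equiv.refl _))
  let f : K2222 ≃g K2222 := ⟨e, by
    intro a b
    rw [K2222_adj, K2222_adj]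
    simp [e]⟩
  refine ⟨f.trans φ, ?_, ?_, ?_⟩ <;> simp [f, e]

theorem exists_iso_root {H : SimpleGraph W} (φ : K2222 ≃g H) (x : W) :
    ∃ ψ : K2222 ≃g H, ψ (0, 0) = x := by
  obtain ⟨⟨i, i'⟩, rfl⟩ := φ.surjective x
  have h : ∀ i : Fin 4, ∃ j k : Fin 4, i ≠ j ∧ i ≠ k ∧ j ≠ k := by decide
  obtain ⟨j, k, hij, hik, hjk⟩ := h i
  obtain ⟨ψ, h1, -⟩ := exists_iso_triangle φ (x := φ (i, i')) (p := φ (j, 0)) (q := φ (k, 0))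
    (by rwa [φ.map_adj_iff, K2222_adj]) (by rwa [φ.map_adj_iff, K2222_adj])
    (by rwa [φ.map_adj_iff, K2222_adj])
  exact ⟨ψ, h1⟩

variable {V : Type}

/-- Real representatives of the vertices of a `K2222` in which `none` is the vertex `(0, 0)`. -/
theorem exists_real {X : Set V} {H : SimpleGraph (Option {v // v ∉ X})} (φ : K2222 ≃g H)
    (h0 : φ (0, 0) = none) :
    ∃ r : Fin 4 × Fin 2 → V, ∀ s, s ≠ (0, 0) → ∃ h : r s ∉ X, φ s = some ⟨r s, h⟩ := by
  have h : ∀ s, ∃ v : V, s ≠ (0, 0) → ∃ h : v ∉ X, φ s = some ⟨v, h⟩ := by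
    intro s
    by_cases hs : s = (0, 0)
    · rcases h1 : φ (1, 0) with _ | v
      · rw [← h0] at h1
        exact absurd (φ.injective h1) (by decide)
      · exact ⟨v, fun h => absurd hs h⟩
    · rcases h1 : φ s with _ | v
      · rw [← h0] at h1
        exact absurd (φ.injective h1) hs
      · exact ⟨v, fun _ => ⟨v.2, rfl⟩⟩
  choose r hr using h
  exact ⟨r, hr⟩

end Octahedron

section Separation

variable {V : Type} {G : SimpleGraph V} {X P D E : Set V}

theorem IsSep.mem_cases (hs : IsSep G X P D E) {v : V} (hv : v ∉ X) : v ∈ P ∨ v ∈ D ∨ v ∈ E := by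
  have : v ∈ P ∪ D ∪ E := by rw [hs.union_eq]; exact hv
  rcases this with (h | h) | h
  · exact Or.inl h
  · exact Or.inr (Or.inl h)
  · exact Or.inr (Or.inr h)

theorem IsSep.notMem_of_mem_sep (hs : IsSep G X P D E) {v : V} (hv : v ∈ P) : v ∉ X := by
  have : v ∈ Xᶜ := by rw [← hs.union_eq]; exact Or.inl (Or.inl hv)
  exact this

theorem IsSep.notMem_of_mem_left (hs : IsSep G X P D E) {v : V} (hv : v ∈ D) : v ∉ X := by
  have : v ∈ Xᶜ := by rw [← hs.union_eq]; exact Or.inl (Or.inr hv)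
  exact this

theorem IsSep.notMem_of_mem_right (hs : IsSep G X P D E) {v : V} (hv : v ∈ E) : v ∉ X :=
  hs.symm.notMem_of_mem_left hv

theorem IsSep.compl_union (hs : IsSep G X P D E) : (X ∪ D)ᶜ = P ∪ E := by
  ext v
  have h1 := fun h => hs.mem_cases (v := v) h
  have h2 := fun h => hs.notMem_of_mem_sep (v := v) h
  have h3 := fun h => hs.notMem_of_mem_right (v := v) h
  have h4 : v ∈ P → v ∉ D := fun h => Set.disjoint_left.1 hs.disj_left h
  have h5 : v ∈ D → v ∉ E := fun h => Set.disjoint_left.1 hs.disj h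
  simp only [Set.mem_compl_iff, Set.mem_union]
  tauto

theorem IsSep.ncard_compl [Finite V] (hs : IsSep G X P D E) :
    Xᶜ.ncard = P.ncard + D.ncard + E.ncard := by
  rw [← hs.union_eq, Set.ncard_union_eq (Set.disjoint_union_left.2 ⟨hs.disj_right, hs.disj⟩),
    Set.ncard_union_eq hs.disj_left]

theorem IsSep.ncard_compl_union [Finite V] (hs : IsSep G X P D E) :
    (X ∪ D)ᶜ.ncard = P.ncard + E.ncard := by
  rw [hs.compl_union, Set.ncard_union_eq hs.disj_right]

theorem IsSep.ncard_union [Finite V] (hs : IsSep G X P D E) :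
    (X ∪ D).ncard = X.ncard + D.ncard :=
  Set.ncard_union_eq (Set.disjoint_left.2 fun _ h h' => hs.notMem_of_mem_left h' h)

theorem IsSep.conn_union [Finite V] (hG : Bdry4 G) (hX : Conn G X) (hs : IsSep G X P D E)
    (hP : P.ncard ≤ 2) : Conn G (X ∪ D) := by
  obtain ⟨x, hx⟩ := hX.1
  obtain ⟨K, hK, hxK⟩ := exists_isComp (G := G) (S := X ∪ D) (Or.inl hx)
  have hXK : X ⊆ K := hK.subset_of_meets hX Set.subset_union_left ⟨x, hx, hxK⟩
  suffices h : K = X ∪ D by rw [← h]; exact hK.2.1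
  refine Set.Subset.antisymm hK.1 fun y hy => ?_
  by_contra hyK
  have hsub : bdry G ((X ∪ D) \ K) ⊆ P := by
    rintro b ⟨hb, a, ⟨haXD, haK⟩, hab⟩
    have haD : a ∈ D := haXD.elim (fun h => absurd (hXK h) haK) id
    by_contra hbP
    have hbK : b ∉ K := fun h => haK (hK.2.2 b h a haXD hab.symm)
    rcases hs.mem_cases (fun h => hbK (hXK h)) with h1 | h1 | h1
    · exact hbP h1
    · exact hb ⟨Or.inr h1, hbK⟩
    · exact hs.not_adj a haD b h1 hab
  have h4 := hG ((X ∪ D) \ K) ⟨y, hy, hyK⟩ ⟨x, fun h => h.2 hxK, fun h =>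
    hs.notMem_of_mem_sep (hsub h) hx⟩
  have := Set.ncard_le_ncard hsub
  omega

theorem IsSep.rho_add_rho [Finite V] (hG : Bdry4 G) (hX : X.Nonempty) (hs : IsSep G X P D E)
    (hP : P.ncard ≤ 2) :
    rho G X + adjCount G P + 8 - 6 * P.ncard +
      2 * ((bdry G (X ∪ D) ∩ bdry G (X ∪ E)).ncard - (bdry G X ∩ P).ncard : ℤ) ≤
      rho G (X ∪ D) + rho G (X ∪ E) := by
  have h1 := adjCount_add_adjCount (P := P) hs.disj hs.not_adj
  rw [hs.union_eq] at h1
  have h2 := Set.ncard_union_add_ncard_inter (bdry G (X ∪ D)) (bdry G (X ∪ E))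
  have h3 := Set.ncard_union_add_ncard_inter (bdry G X) P
  have hsub : bdry G X ∪ P ⊆ bdry G (X ∪ D) ∪ bdry G (X ∪ E) := by
    rintro b (⟨hb, x, hx, hxb⟩ | hb)
    · by_cases hbD : b ∈ D
      · refine Or.inr ⟨?_, x, Or.inl hx, hxb⟩
        rintro (h | h)
        · exact hb h
        · exact Set.disjoint_left.1 hs.disj hbD h
      · exact Or.inl ⟨fun h => h.elim hb hbD, x, Or.inl hx, hxb⟩
    · have hbD := Set.disjoint_left.1 hs.disj_left hb
      have hbE := Set.disjoint_left.1 hs.disj_right hb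
      have hbX := hs.notMem_of_mem_sep hb
      by_contra hno
      have hsub : bdry G {b} ⊆ P := by
        rintro y ⟨hy, b', hb', hby⟩
        rw [Set.mem_singleton_iff] at hb'
        subst hb'
        by_contra hyP
        by_cases hyX : y ∈ X
        · exact hno (Or.inl ⟨fun h => h.elim hbX hbD, y, Or.inl hyX, hby.symm⟩)
        rcases hs.mem_cases hyX with h | h | h
        · exact hyP h
        · exact hno (Or.inl ⟨fun h => h.elim hbX hbD, y, Or.inr h, hby.symm⟩)
        · exact hno (Or.inr ⟨fun h => h.elim hbX hbE, y, Or.inr h, hby.symm⟩)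
      obtain ⟨x, hx⟩ := hX
      have h4 := hG {b} ⟨b, rfl⟩ ⟨x, fun h => hbX (by rw [← Set.mem_singleton_iff.1 h]; exact hx),
        fun h => hs.notMem_of_mem_sep (hsub h) hx⟩
      have := Set.ncard_le_ncard hsub
      omega
  have h4 := Set.ncard_le_ncard hsub
  have h5 := hs.ncard_compl
  have h6 := hs.ncard_compl_union
  have h7 := hs.symm.ncard_compl_union
  unfold rho
  rw [h6, h7, hs.compl_union, hs.symm.compl_union, h5]
  omega

/-- `X` is a largest connected set whose contraction keeps the number of edges large. -/
structure IsMaxContr (G : SimpleGraph V) (X : Set V) : Prop where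
  conn : Conn G X
  two_le : 2 ≤ X.ncard
  two_le_compl : 2 ≤ Xᶜ.ncard
  rho_nonneg : 0 ≤ rho G X
  max : ∀ Z, Conn G Z → X.ncard < Z.ncard → 2 ≤ Zᶜ.ncard → rho G Z < 0

namespace IsMaxContr

theorem six_le [Finite V] (hX : IsMaxContr G X) : 6 ≤ Xᶜ.ncard := by
  have h1 := hX.rho_nonneg
  rw [← excess_contr] at h1
  have h2 := seven_le_of_excess_nonneg h1
  rw [card_contr] at h2
  have := hX.two_le_compl
  omega

theorem rho_le [Finite V] (hX : IsMaxContr G X) (hG : Bdry4 G) (hs : IsSep G X P D E)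
    (hP : P.ncard ≤ 2) (h2 : 2 ≤ P.ncard + E.ncard) : rho G (X ∪ D) ≤ -2 := by
  have h1 := hX.max (X ∪ D) (hs.conn_union hG hX.conn hP) (by
    rw [hs.ncard_union]
    have := (Set.ncard_pos (s := D)).2 hs.left_nonempty
    omega) (by rwa [hs.ncard_compl_union])
  obtain ⟨k, hk⟩ := even_rho (G := G) (X ∪ D)
  omega

theorem inter_subset (hs : IsSep G X P D E) :
    bdry G X ∩ P ⊆ bdry G (X ∪ D) ∩ bdry G (X ∪ E) := by
  rintro b ⟨⟨hb, x, hx, hxb⟩, hbP⟩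
  exact ⟨⟨fun h => h.elim hb (Set.disjoint_left.1 hs.disj_left hbP), x, Or.inl hx, hxb⟩,
    ⟨fun h => h.elim hb (Set.disjoint_left.1 hs.disj_right hbP), x, Or.inl hx, hxb⟩⟩

theorem sep_ne_one [Finite V] (hX : IsMaxContr G X) (hG : Bdry4 G) (hs : IsSep G X P D E) :
    P.ncard ≠ 1 := by
  intro h1
  have hD := (Set.ncard_pos (s := D)).2 hs.left_nonempty
  have hE := (Set.ncard_pos (s := E)).2 hs.right_nonempty
  have h2 := hX.rho_le hG hs (by omega) (by omega)
  have h3 := hX.rho_le hG hs.symm (by omega) (by omega)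
  have h4 := hs.rho_add_rho hG hX.conn.1 (by omega)
  have h5 := Set.ncard_le_ncard (inter_subset hs)
  have h6 := hX.rho_nonneg
  omega

theorem sep_eq_two [Finite V] (hX : IsMaxContr G X) (hG : Bdry4 G) (hs : IsSep G X P D E)
    (hP : P.ncard ≤ 2) : P.ncard = 2 := by
  have key : ∀ D E, IsSep G X P D E → P.ncard = 0 → 2 ≤ D.ncard → False := by
    intro D E hs h0 hD
    rw [Set.ncard_eq_zero] at h0
    subst h0
    obtain ⟨a, ha, b, hb, hab⟩ := (Set.one_lt_ncard_iff_nontrivial (s := D)).1 (by omega)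
    refine hX.sep_ne_one hG (P := {a}) (D := D \ {a}) (E := E) ⟨?_, ?_, ?_, ?_, ⟨b, hb, hab.symm⟩,
      hs.right_nonempty, fun d hd => hs.not_adj d hd.1⟩ (Set.ncard_singleton a)
    · rw [← hs.union_eq, Set.empty_union, Set.union_sdiff_cancel (by simpa using ha)]
    · exact Set.disjoint_sdiff_right
    · exact Set.disjoint_singleton_left.2 fun h => Set.disjoint_left.1 hs.disj ha h
    · exact hs.disj.mono_left Set.sdiff_subset
  have h1 := hX.sep_ne_one hG hs
  have h2 := hs.ncard_compl
  have h3 := hX.six_le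
  by_contra hne
  by_cases hD : 2 ≤ D.ncard
  · exact key D E hs (by omega) hD
  · exact key E D hs.symm (by omega) (by omega)

/-- Each vertex of a minimum separator has a neighbour on either side. -/
theorem adj_right [Finite V] (hX : IsMaxContr G X) (hG : Bdry4 G) (hs : IsSep G X P D E)
    (hP : P.ncard ≤ 2) {q : V} (hq : q ∈ P) : ∃ e ∈ E, G.Adj q e := by
  by_contra hno
  push Not at hno
  have h2 := hX.sep_eq_two hG hs hP
  refine hX.sep_ne_one hG (P := P \ {q}) (D := insert q D) (E := E) ⟨?_, ?_, ?_, ?_, ⟨q, Or.inl rfl⟩,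
      hs.right_nonempty, ?_⟩ (by rw [Set.ncard_sdiff_singleton_of_mem hq, h2])
  · rw [← hs.union_eq, ← Set.union_singleton, Set.union_comm D, ← Set.union_assoc,
      Set.sdiff_union_of_subset (by simpa using hq)]
  · rw [Set.disjoint_left]
    rintro x hx (h | h)
    · exact hx.2 h
    · exact Set.disjoint_left.1 hs.disj_left hx.1 h
  · exact hs.disj_right.mono_left Set.sdiff_subset
  · rw [Set.disjoint_left]
    rintro x (rfl | h) h'
    · exact Set.disjoint_left.1 hs.disj_right hq h'
    · exact Set.disjoint_left.1 hs.disj h h'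
  · rintro d (rfl | hd) e he
    · exact hno e he
    · exact hs.not_adj d hd e he

theorem conn_insert_right [Finite V] (hX : IsMaxContr G X) (hG : Bdry4 G) (hs : IsSep G X P D E)
    (hP : P.ncard ≤ 2) {p : V} (hp : p ∈ P) : Conn G (insert p E) := by
  have h2 := hX.sep_eq_two hG hs hP
  obtain ⟨K, hK, hpK⟩ := exists_isComp (G := G) (S := insert p E) (Or.inl rfl)
  suffices h : K = insert p E by rw [← h]; exact hK.2.1
  refine Set.Subset.antisymm hK.1 fun y hy => ?_
  by_contra hyK
  have hyE : y ∈ E := hy.elim (fun h => absurd (h ▸ hpK) hyK) id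
  refine hX.sep_ne_one hG (P := P \ {p}) (D := D ∪ K) (E := E \ K) ⟨?_, ?_, ?_, ?_,
    ⟨p, Or.inr hpK⟩, ⟨y, hyE, hyK⟩, ?_⟩ (by rw [Set.ncard_sdiff_singleton_of_mem hp, h2])
  · rw [← hs.union_eq]
    ext x
    have h1 : x ∈ K → x = p ∨ x ∈ E := fun h => hK.1 h
    have h3 : x = p → x ∈ P := fun h => h ▸ hp
    have h4 : x = p → x ∈ K := fun h => h ▸ hpK
    simp only [Set.mem_union, Set.mem_sdiff, Set.mem_singleton_iff]
    tauto
  · rw [Set.disjoint_left]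
    rintro x hx (h | h)
    · exact Set.disjoint_left.1 hs.disj_left hx.1 h
    · rcases hK.1 h with h' | h'
      · exact hx.2 h'
      · exact Set.disjoint_left.1 hs.disj_right hx.1 h'
  · exact hs.disj_right.mono Set.sdiff_subset Set.sdiff_subset
  · rw [Set.disjoint_left]
    rintro x (h | h) h'
    · exact Set.disjoint_left.1 hs.disj h h'.1
    · exact h'.2 h
  · rintro d (hd | hd) e he hde
    · exact hs.not_adj d hd e he.1 hde
    · exact he.2 (hK.2.2 d hd e (Or.inr he.1) hde)

theorem sep_subset_bdry_and_adjCount [Finite V] (hX : IsMaxContr G X) (hG : Bdry4 G)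
    (hs : IsSep G X P D E) (hP : P.ncard ≤ 2) :
    P ⊆ bdry G X ∧ adjCount G P = 0 ∧ rho G (X ∪ E) = -2 := by
  have h2 := hX.sep_eq_two hG hs hP
  have h3 := hX.rho_le hG hs (by omega) (by omega)
  have h4 := hX.rho_le hG hs.symm (by omega) (by omega)
  have h5 := hs.rho_add_rho hG hX.conn.1 (by omega)
  have h6 := Set.ncard_le_ncard (inter_subset hs)
  have h7 := hX.rho_nonneg
  refine ⟨fun p hp => ?_, by omega, by omega⟩
  have h8 := Set.eq_of_subset_of_ncard_le (inter_subset hs) (by omega)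
  have hpX := hs.notMem_of_mem_sep hp
  obtain ⟨e, he, hpe⟩ := hX.adj_right hG hs hP hp
  obtain ⟨d, hd, hpd⟩ := hX.adj_right hG hs.symm hP hp
  have : p ∈ bdry G X ∩ P := by
    rw [h8]
    exact ⟨⟨fun h => h.elim hpX (Set.disjoint_left.1 hs.disj_left hp), d, Or.inr hd, hpd.symm⟩,
      ⟨fun h => h.elim hpX (Set.disjoint_left.1 hs.disj_right hp), e, Or.inr he, hpe.symm⟩⟩
  exact this.1

end IsMaxContr

end Separation

section Lift

variable {V W : Type} {G : SimpleGraph V}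

theorem adjCount_sup_edge [Finite W] {H : SimpleGraph W} {a b : W} (hab : a ≠ b)
    (h : ¬ H.Adj a b) :
    adjCount (H ⊔ SimpleGraph.edge a b) Set.univ = adjCount H Set.univ + 2 := by
  have h2 : ({(a, b), (b, a)} : Set (W × W)).ncard = 2 :=
    Set.ncard_pair fun e => hab (Prod.mk.inj e).1
  rw [adjCount, adjCount, ← h2, ← Set.ncard_union_eq]
  · congr 1
    ext ⟨x, y⟩
    simp only [Set.mem_ofPred_eq, Set.mem_univ, true_and, SimpleGraph.sup_adj,
      SimpleGraph.edge_adj, Set.mem_union, Set.mem_insert_iff, Set.mem_singleton_iff,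
      Prod.mk.injEq]
    grind
  · rw [Set.disjoint_left]
    rintro _ ⟨-, -, hxy⟩ (rfl | rfl)
    · exact h hxy
    · exact h hxy.symm

variable {X P D E : Set V}

/-- In the situation of a minimum separator `{p, q}`, contracting one side onto `p` and keeping `X`
yields the other side with an extra edge `pq`. -/
theorem isMinor_contr_sup_edge (hX : Conn G X) (hs : IsSep G X P D E) (hP : P ⊆ bdry G X)
    {p q : V} (hp : p ∉ X ∪ E) (hq : q ∉ X ∪ E) (hpE : Conn G (insert p E))
    (hqE : ∃ e ∈ E, G.Adj q e) :
    IsMinor (contr G (X ∪ E) ⊔ SimpleGraph.edge (some ⟨p, hp⟩) (some ⟨q, hq⟩)) G := by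
  let bag : Option {v // v ∉ X ∪ E} → Set V := fun w =>
    w.elim X fun v => {x | x = v ∨ ((v : V) = p ∧ x ∈ E)}
  have hself : ∀ v : {v // v ∉ X ∪ E}, (v : V) ∈ bag (some v) := fun v => Or.inl rfl
  have hadj : ∀ w w', (contr G (X ∪ E)).Adj w w' → ∃ u ∈ bag w, ∃ v ∈ bag w', G.Adj u v := by
    have hnone : ∀ v : {v // v ∉ X ∪ E}, (v : V) ∈ bdry G (X ∪ E) → ∃ x ∈ X, G.Adj x v := by
      rintro ⟨v, hv⟩ ⟨-, x, hx | hx, hxv⟩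
      · exact ⟨x, hx, hxv⟩
      · rcases hs.mem_cases (fun h => hv (Or.inl h)) with h | h | h
        · exact (hP h).2
        · exact absurd hxv.symm (hs.not_adj v h x hx)
        · exact absurd (Or.inr h) hv
    rintro (_ | u) (_ | v) h
    · exact absurd h (SimpleGraph.irrefl _)
    · obtain ⟨x, hx, hxv⟩ := hnone v ((contr_none_some v).1 h)
      exact ⟨x, hx, v, hself v, hxv⟩
    · obtain ⟨x, hx, hxv⟩ := hnone u ((contr_some_none u).1 h)
      exact ⟨u, hself u, x, hx, hxv.symm⟩
    · exact ⟨u, hself u, v, hself v, h⟩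
  have hXdisj : ∀ v : {v // v ∉ X ∪ E}, Disjoint X (bag (some v)) := by
    intro v
    rw [Set.disjoint_left]
    rintro x hx (rfl | ⟨-, hxE⟩)
    · exact v.2 (Or.inl hx)
    · exact hs.notMem_of_mem_right hxE hx
  obtain ⟨e, he, hqe⟩ := hqE
  refine ⟨bag, ?_, ?_, ?_⟩
  · rintro (_ | v)
    · exact (conn_iff _ _).2 hX
    · refine (conn_iff _ _).2 ?_
      by_cases hv : (v : V) = p
      · convert hpE using 1
        ext x
        simp [bag, hv]
      · convert conn_singleton G (v : V) using 1
        ext x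
        simp [bag, hv]
  · rintro (_ | u) (_ | v) huv
    · exact absurd rfl huv
    · exact hXdisj v
    · exact (hXdisj u).symm
    · rw [Set.disjoint_left]
      rintro x (rfl | ⟨hu, hxE⟩) (hxv | ⟨hv, hxE'⟩)
      · exact huv (congrArg some (Subtype.ext hxv))
      · exact u.2 (Or.inr hxE')
      · exact v.2 (Or.inr (hxv ▸ hxE))
      · exact huv (congrArg some (Subtype.ext (hu.trans hv.symm)))
  · rintro w w' (h | h)
    · exact hadj w w' h
    · rw [SimpleGraph.edge_adj] at h
      rcases h.1 with ⟨rfl, rfl⟩ | ⟨rfl, rfl⟩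
      · exact ⟨e, Or.inr ⟨rfl, he⟩, q, Or.inl rfl, hqe.symm⟩
      · exact ⟨q, Or.inl rfl, e, Or.inr ⟨rfl, he⟩, hqe⟩

/-- If one side of the separator is smallest possible, the graph with the other side contracted and
the separator turned into an edge has no small cut. -/
theorem IsMaxContr.bdry4_contr_sup_edge [Finite V] (hX : IsMaxContr G X) (hG : Bdry4 G)
    (hs : IsSep G X P D E)
    (hmin : ∀ P' D' E', IsSep G X P' D' E' → P'.ncard ≤ 2 → D.ncard ≤ D'.ncard)
    {p q : V} (hP : P = {p, q}) (hp : p ∉ X ∪ E) (hq : q ∉ X ∪ E) (hpq : p ≠ q) :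
    Bdry4 (contr G (X ∪ E) ⊔ SimpleGraph.edge (some ⟨p, hp⟩) (some ⟨q, hq⟩)) := by
  by_contra hb
  obtain ⟨P', D', E', hs', hP', hno⟩ := exists_isSep hG (hX.conn.1.mono Set.subset_union_left)
    le_sup_left hb
  have hPc : P.ncard = 2 := by rw [hP, Set.ncard_pair hpq]
  have key : ∀ D' E', IsSep G (X ∪ E) P' D' E' → p ∉ D' → q ∉ D' → False := by
    intro D' E' hs' hpD hqD
    have hD' : D' ⊆ D := by
      intro d hd
      have hdY := hs'.notMem_of_mem_left hd
      rcases hs.mem_cases (fun h => hdY (Or.inl h)) with h | h | h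
      · rw [hP] at h
        rcases h with rfl | h
        · exact absurd hd hpD
        · exact absurd (Set.mem_singleton_iff.1 h ▸ hd) hqD
      · exact h
      · exact absurd (Or.inr h) hdY
    have hs2 : IsSep G X P' D' (E' ∪ E) := by
      refine ⟨?_, hs'.disj_left, ?_, ?_, hs'.left_nonempty, hs'.right_nonempty.inl, ?_⟩
      · rw [← Set.union_assoc, hs'.union_eq]
        ext x
        have := fun h => hs.notMem_of_mem_right (v := x) h
        simp only [Set.mem_union, Set.mem_compl_iff]
        tauto
      · rw [Set.disjoint_left]
        rintro x hx (h | h)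
        · exact Set.disjoint_left.1 hs'.disj_right hx h
        · exact hs'.notMem_of_mem_sep hx (Or.inr h)
      · rw [Set.disjoint_left]
        rintro x hx (h | h)
        · exact Set.disjoint_left.1 hs'.disj hx h
        · exact hs'.notMem_of_mem_left hx (Or.inr h)
      · rintro d hd e (he | he)
        · exact hs'.not_adj d hd e he
        · exact hs.not_adj d (hD' hd) e he
    have hDD : D' = D := Set.eq_of_subset_of_ncard_le hD' (hmin _ _ _ hs2 hP')
    have hsub : ∀ x, x ∉ X ∪ E → x ∉ D' → x ∈ P := by
      intro x hx hxD
      rcases hs.mem_cases (fun h => hx (Or.inl h)) with h | h | h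
      · exact h
      · exact absurd (hDD ▸ h) hxD
      · exact absurd (Or.inr h) hx
    have hPP : P' = P := by
      refine Set.eq_of_subset_of_ncard_le (fun x hx => hsub x (hs'.notMem_of_mem_sep hx)
        (Set.disjoint_left.1 hs'.disj_left hx)) ?_
      rw [hX.sep_eq_two hG hs2 hP', hPc]
    obtain ⟨e, he⟩ := hs'.right_nonempty
    refine Set.disjoint_left.1 hs'.disj_right ?_ he
    rw [hPP]
    exact hsub e (hs'.notMem_of_mem_right he) fun h => Set.disjoint_left.1 hs'.disj h he
  have hadj : (contr G (X ∪ E) ⊔ SimpleGraph.edge (some ⟨p, hp⟩) (some ⟨q, hq⟩)).Adj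
      (some ⟨p, hp⟩) (some ⟨q, hq⟩) :=
    Or.inr ((SimpleGraph.edge_adj ..).2 ⟨Or.inl ⟨rfl, rfl⟩, fun h => hpq (by simpa using h)⟩)
  have h1 : p ∈ D' → q ∉ E' := fun h h' => hno ⟨p, hp⟩ ⟨q, hq⟩ h h' hadj
  have h2 : q ∈ D' → p ∉ E' := fun h h' => hno ⟨q, hq⟩ ⟨p, hp⟩ h h' hadj.symm
  have h3 : p ∈ D' → p ∉ E' := fun h => Set.disjoint_left.1 hs'.disj h
  have h4 : q ∈ D' → q ∉ E' := fun h => Set.disjoint_left.1 hs'.disj h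
  by_cases h5 : p ∈ D'
  · exact key E' D' hs'.symm (h3 h5) (h1 h5)
  by_cases h6 : q ∈ D'
  · exact key E' D' hs'.symm (h2 h6) (h4 h6)
  · exact key D' E' hs' h5 h6

theorem IsMaxContr.bdry4_contr [Fintype V] (h : MinorMinimalEnemy G) (hX : IsMaxContr G X) :
    Bdry4 (contr G X) := by
  have hG := h.bdry4
  by_contra hb
  obtain ⟨P₀, D₀, E₀, hs₀, hP₀, -⟩ := exists_isSep hG hX.conn.1 le_rfl hb
  obtain ⟨D, ⟨P, E, hs, hP⟩, hmin⟩ := exists_min_set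
    (fun D => ∃ P E, IsSep G X P D E ∧ P.ncard ≤ 2) ⟨D₀, P₀, E₀, hs₀, hP₀⟩
  have hP2 := hX.sep_eq_two hG hs hP
  obtain ⟨hPX, hPadj, hrho⟩ := hX.sep_subset_bdry_and_adjCount hG hs hP
  obtain ⟨p, q, hpq, hPe⟩ := Set.ncard_eq_two.1 hP2
  have hpP : p ∈ P := by rw [hPe]; exact Or.inl rfl
  have hqP : q ∈ P := by rw [hPe]; exact Or.inr rfl
  have hnY : ∀ x ∈ P, x ∉ X ∪ E := fun x hx h =>
    h.elim (hs.notMem_of_mem_sep hx) (Set.disjoint_left.1 hs.disj_right hx)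
  have hp := hnY p hpP
  have hq := hnY q hqP
  have hnadj : ¬ G.Adj p q := by
    intro hadj
    rw [adjCount, Set.ncard_eq_zero] at hPadj
    exact Set.notMem_empty (p, q) (hPadj ▸ ⟨hpP, hqP, hadj⟩)
  set Y := X ∪ E with hY
  set H := contr G Y ⊔ SimpleGraph.edge (some ⟨p, hp⟩) (some ⟨q, hq⟩) with hH
  have hsome : (some ⟨p, hp⟩ : Option {v // v ∉ Y}) ≠ some ⟨q, hq⟩ := fun h =>
    hpq (by simpa using h)
  have hexc : excess H = 0 := by
    have h1 := excess_contr (G := G) Y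
    rw [hrho] at h1
    rw [excess] at h1 ⊢
    rw [hH, adjCount_sup_edge hsome (by simpa using hnadj)]
    push_cast
    omega
  have hYcard : Y.ncard = X.ncard + E.ncard := hs.symm.ncard_union
  have hEpos := (Set.ncard_pos (s := E)).2 hs.right_nonempty
  have hDpos := (Set.ncard_pos (s := D)).2 hs.left_nonempty
  have hYc : Yᶜ.ncard = P.ncard + D.ncard := hs.symm.ncard_compl_union
  have hXtwo := hX.two_le
  have hcompl := Set.ncard_add_ncard_compl Y
  obtain ⟨φ₀⟩ := h.nonempty_iso (H := H)
    (isMinor_contr_sup_edge hX.conn hs hPX hp hq (hX.conn_insert_right hG hs hP hpP)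
      (hX.adj_right hG hs hP hqP))
    (by rw [card_contr]; omega) (by rw [card_contr]; omega)
    (hX.bdry4_contr_sup_edge hG hs (fun P' D' E' h1 h2 => hmin D' ⟨P', E', h1, h2⟩) hPe hp hq hpq)
    hexc.ge
  have hbd : ∀ x ∈ P, x ∈ bdry G Y := fun x hx => by
    obtain ⟨-, y, hy, hyx⟩ := hPX hx
    exact ⟨hnY x hx, y, Or.inl hy, hyx⟩
  obtain ⟨φ, h0, hφp, hφq⟩ := exists_iso_triangle φ₀ (x := none) (p := some ⟨p, hp⟩)
    (q := some ⟨q, hq⟩) (Or.inl ((contr_none_some _).2 (hbd p hpP)))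
    (Or.inl ((contr_none_some _).2 (hbd q hqP)))
    (Or.inr ((SimpleGraph.edge_adj ..).2 ⟨Or.inl ⟨rfl, rfl⟩, hsome⟩))
  obtain ⟨r, hr⟩ := exists_real φ h0
  have hrp : r (1, 0) = p := by
    obtain ⟨h1, h2⟩ := hr (1, 0) (by decide)
    rw [hφp] at h2
    simpa using h2.symm
  have hrq : r (2, 0) = q := by
    obtain ⟨h1, h2⟩ := hr (2, 0) (by decide)
    rw [hφq] at h2
    simpa using h2.symm
  have hrinj : ∀ s t, s ≠ (0, 0) → t ≠ (0, 0) → r s = r t → s = t := by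
    intro s t hs ht hst
    obtain ⟨h1, h2⟩ := hr s hs
    obtain ⟨h3, h4⟩ := hr t ht
    apply φ.injective
    rw [h2, h4]
    simp [hst]
  have hadj : ∀ s t, s ≠ (0, 0) → t ≠ (0, 0) → s.1 ≠ t.1 → ¬ (s = (1, 0) ∧ t = (2, 0)) →
      ¬ (s = (2, 0) ∧ t = (1, 0)) → G.Adj (r s) (r t) := by
    intro s t hs ht hst h1 h2
    obtain ⟨h3, h4⟩ := hr s hs
    obtain ⟨h5, h6⟩ := hr t ht
    have h7 := φ.map_adj_iff.2 ((K2222_adj s t).2 hst)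
    rw [h4, h6] at h7
    rcases h7 with h7 | h7
    · exact h7
    · exfalso
      rw [SimpleGraph.edge_adj] at h7
      simp only [Option.some.injEq, Subtype.mk.injEq] at h7
      rcases h7.1 with ⟨h8, h9⟩ | ⟨h8, h9⟩
      · rw [← hrp] at h8
        rw [← hrq] at h9
        exact h1 ⟨hrinj _ _ hs (by decide) h8, hrinj _ _ ht (by decide) h9⟩
      · rw [← hrq] at h8
        rw [← hrp] at h9
        exact h2 ⟨hrinj _ _ hs (by decide) h8, hrinj _ _ ht (by decide) h9⟩
  have hnad : ∀ s t, s ≠ (0, 0) → t ≠ (0, 0) → G.Adj (r s) (r t) → s.1 ≠ t.1 := by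
    intro s t hs ht hst
    obtain ⟨h3, h4⟩ := hr s hs
    obtain ⟨h5, h6⟩ := hr t ht
    rw [← K2222_adj, ← φ.map_adj_iff, h4, h6]
    exact Or.inl hst
  have hN : ∀ x, G.Adj (r (0, 1)) x → ∃ t : Fin 4 × Fin 2, t.1 ≠ 0 ∧ x = r t := by
    intro x hx
    obtain ⟨h1, h2⟩ := hr (0, 1) (by decide)
    have hxY : x ∉ Y := by
      intro hxY
      have h3 : H.Adj (φ (0, 0)) (φ (0, 1)) := by
        rw [h0, h2]
        exact Or.inl ((contr_none_some _).2 ⟨h1, x, hxY, hx.symm⟩)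
      rw [φ.map_adj_iff, K2222_adj] at h3
      exact h3 rfl
    obtain ⟨t, ht⟩ := φ.surjective (some ⟨x, hxY⟩)
    have ht0 : t ≠ (0, 0) := by
      rintro rfl
      rw [h0] at ht
      exact absurd ht (by simp)
    obtain ⟨h3, h4⟩ := hr t ht0
    have hxt : x = r t := by
      rw [ht] at h4
      simpa using h4
    exact ⟨t, fun h => hnad (0, 1) t (by decide) ht0 (hxt ▸ hx) h.symm, hxt⟩
  have hcases : ∀ t : Fin 4 × Fin 2, t.1 ≠ 0 → t = (1, 0) ∨ t = (1, 1) ∨ t = (2, 0) ∨ t = (2, 1) ∨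
      t = (3, 0) ∨ t = (3, 1) := by decide
  have hW : IsWheel G (r (1, 1)) (r (2, 0)) (r (2, 1)) (r (3, 0)) (r (3, 1)) := by
    constructor
    on_goal 9 => exact fun h => absurd (hrinj _ _ (by decide) (by decide) h) (by decide)
    on_goal 9 => exact fun h => absurd (hrinj _ _ (by decide) (by decide) h) (by decide)
    all_goals exact hadj _ _ (by decide) (by decide) (by decide) (by decide) (by decide)
  have hxp : G.Adj (r (0, 1)) (r (1, 0)) :=
    hadj _ _ (by decide) (by decide) (by decide) (by decide) (by decide)
  have hb' : Bdry4 (contr G {r (0, 1), r (1, 0)}) := by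
    refine bdry4_contr_of_wheel hG hW ?_ ?_
    · rintro x (rfl | rfl | rfl | rfl | rfl) (h | h) <;>
        exact absurd (hrinj _ _ (by decide) (by decide) h) (by decide)
    · intro x hx
      obtain ⟨t, ht, rfl⟩ := hN x hx
      rcases hcases t ht with rfl | rfl | rfl | rfl | rfl | rfl <;> simp
  have hc : (G.neighborSet (r (0, 1)) ∩ G.neighborSet (r (1, 0))).ncard ≤ 3 := by
    have hsub : G.neighborSet (r (0, 1)) ∩ G.neighborSet (r (1, 0)) ⊆
        {r (2, 1), r (3, 0), r (3, 1)} := by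
      rintro x ⟨hx1, hx2⟩
      obtain ⟨t, ht, rfl⟩ := hN x hx1
      rcases hcases t ht with rfl | rfl | rfl | rfl | rfl | rfl
      · exact absurd rfl (hnad (1, 0) (1, 0) (by decide) (by decide) hx2)
      · exact absurd rfl (hnad (1, 0) (1, 1) (by decide) (by decide) hx2)
      · rw [hrp, hrq] at hx2
        exact absurd hx2 hnadj
      · simp
      · simp
      · simp
    refine (Set.ncard_le_ncard hsub).trans ?_
    refine (Set.ncard_insert_le _ _).trans ?_
    have := Set.ncard_insert_le (r (3, 0)) {r (3, 1)}
    rw [Set.ncard_singleton] at this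
    omega
  have hpair := Set.ncard_pair hxp.ne
  have hpc := Set.ncard_add_ncard_compl ({r (0, 1), r (1, 0)} : Set V)
  have h5 := h.five_le_card
  have hrho' := rho_pair hxp
  have hexG := h.excess_nonneg
  obtain ⟨ψ⟩ := h.iso_contr (conn_pair hxp) hpair.ge (by omega) (by omega) hb'
  have c1 := Nat.card_congr φ.toEquiv
  have c2 := Nat.card_congr ψ.toEquiv
  rw [card_contr] at c1 c2
  omega

end Lift

section OctaFrame

variable {V : Type} {G : SimpleGraph V}

theorem isMinor_K7vee {C : Fin 6 → Set V} {S : Set V} {i j : Fin 6} (hC : ∀ k, Conn G (C k))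
    (hdisj : ∀ k l, k < l → Disjoint (C k) (C l))
    (hadj : ∀ k l, k < l → ∃ x ∈ C k, ∃ y ∈ C l, G.Adj x y) (hS : Conn G S)
    (hSdisj : ∀ k, Disjoint S (C k)) (hij : i ≠ j)
    (hSadj : ∀ k, k ≠ i → k ≠ j → ∃ x ∈ S, ∃ y ∈ C k, G.Adj x y) : IsMinor K7vee G := by
  have hswap : ∀ i j : Fin 6, i ≠ j → Equiv.swap 0 i (Equiv.swap 1 (Equiv.swap 0 i j) 0) = i := by
    decide
  obtain ⟨σ, h0, h1⟩ : ∃ σ : Equiv.Perm (Fin 6), σ 0 = i ∧ σ 1 = j :=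
    ⟨Equiv.swap 0 i * Equiv.swap 1 (Equiv.swap 0 i j), hswap i j hij, by simp⟩
  have hdisj' : ∀ k l, k ≠ l → Disjoint (C k) (C l) := fun k l hkl =>
    hkl.lt_or_gt.elim (hdisj k l) fun h => (hdisj l k h).symm
  have hadj' : ∀ k l, k ≠ l → ∃ x ∈ C k, ∃ y ∈ C l, G.Adj x y := fun k l hkl =>
    hkl.lt_or_gt.elim (hadj k l) fun h => by
      obtain ⟨x, hx, y, hy, hxy⟩ := hadj l k h
      exact ⟨y, hy, x, hx, hxy.symm⟩
  have hS' : ∀ k : Fin 6, K7vee.Adj 0 k.succ → ∃ x ∈ S, ∃ y ∈ C (σ k), G.Adj x y := by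
    intro k hk
    refine hSadj _ ?_ ?_
    · rintro rfl
      rw [σ.injective.eq_iff] at h0
      subst h0
      simp [K7vee] at hk
    · rintro rfl
      rw [σ.injective.eq_iff] at h1
      subst h1
      simp [K7vee] at hk
  refine ⟨Fin.cons S (C ∘ σ), ?_, ?_, ?_⟩
  · intro w
    rw [conn_iff]
    cases w using Fin.cases with
    | zero => exact hS
    | succ k => exact hC _
  · intro w w' hw
    cases w using Fin.cases with
    | zero =>
      cases w' using Fin.cases with
      | zero => exact absurd rfl hw
      | succ l => exact hSdisj _
    | succ k =>
      cases w' using Fin.cases with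
      | zero => exact (hSdisj _).symm
      | succ l => exact hdisj' _ _ fun h => hw (congrArg _ (σ.injective h))
  · intro w w' hw
    cases w using Fin.cases with
    | zero =>
      cases w' using Fin.cases with
      | zero => exact absurd hw (SimpleGraph.irrefl _)
      | succ l => exact hS' l hw
    | succ k =>
      cases w' using Fin.cases with
      | zero =>
        obtain ⟨x, hx, y, hy, hxy⟩ := hS' k hw.symm
        exact ⟨y, hy, x, hx, hxy.symm⟩
      | succ l => exact hadj' _ _ fun h => hw.ne (congrArg _ (σ.injective h))

/-- Outside `X` there is an octahedron, with vertices `r s`, together with a vertex `c` adjacent to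
all of it. -/
structure OctaFrame (G : SimpleGraph V) (X : Set V) (c : V) (r : Fin 3 × Fin 2 → V) : Prop where
  inj : Function.Injective r
  adj : ∀ s t, s.1 ≠ t.1 → G.Adj (r s) (r t)
  hub : ∀ s, G.Adj c (r s)
  hub_notMem : c ∉ X
  notMem : ∀ s, r s ∉ X

namespace OctaFrame

variable {X X₁ X₂ : Set V} {c : V} {r : Fin 3 × Fin 2 → V}

theorem ne_succ (F : OctaFrame G X c r) (i : Fin 3) (α : Fin 2) : r (i, α) ≠ r (i, α + 1) :=
  fun h => by simpa using F.inj h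

/-- The six disjoint connected sets used to find a minor: they are pairwise adjacent when the two
vertices with first index `i` both have a neighbour in `Y`. -/
def bags (c : V) (r : Fin 3 × Fin 2 → V) (Y : Set V) (i j k : Fin 3) (α β γ : Fin 2) :
    Fin 6 → Set V :=
  ![{c}, {r (i, α)} ∪ Y, {r (i, α + 1)}, {r (j, β)}, {r (k, γ)}, {r (j, β + 1)} ∪ {r (k, γ + 1)}]

theorem isMinor (F : OctaFrame G X c r) (h₁ : X₁ ⊆ X) (h₂ : X₂ ⊆ X) (hc₁ : Conn G X₁)
    (hc₂ : Conn G X₂) (hd : Disjoint X₁ X₂) (hadj : ∃ x ∈ X₁, ∃ y ∈ X₂, G.Adj x y)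
    {i j k : Fin 3} (hij : i ≠ j) (hik : i ≠ k) (hjk : j ≠ k) {α β γ : Fin 2}
    (hi : ∀ ε, ∃ x ∈ X₁, G.Adj x (r (i, ε))) {e : Fin 6} (he : 0 ≠ e)
    (hX₂ : ∀ l, 2 ≤ l → l ≠ e → ∃ x ∈ X₂, ∃ y ∈ bags c r X₁ i j k α β γ l, G.Adj x y) :
    IsMinor K7vee G := by
  have hn : ∀ s, r s ∉ X₁ := fun s hs => F.notMem s (h₁ hs)
  have hn₂ : ∀ s, r s ∉ X₂ := fun s hs => F.notMem s (h₂ hs)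
  have h1 := (F.ne_succ i α).symm
  have h2 := F.ne_succ j β
  have h3 := F.ne_succ k γ
  have hij' : ∀ α β, G.Adj (r (i, α)) (r (j, β)) := fun _ _ => F.adj _ _ hij
  have hik' : ∀ α β, G.Adj (r (i, α)) (r (k, β)) := fun _ _ => F.adj _ _ hik
  have hjk' : ∀ α β, G.Adj (r (j, α)) (r (k, β)) := fun _ _ => F.adj _ _ hjk
  have eij : ∀ α β, r (j, α) ≠ r (i, β) := fun _ _ => (hij' _ _).ne'
  have eji : ∀ α β, r (i, α) ≠ r (j, β) := fun _ _ => (hij' _ _).ne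
  have eki : ∀ α β, r (i, α) ≠ r (k, β) := fun _ _ => (hik' _ _).ne
  have eik : ∀ α β, r (k, α) ≠ r (i, β) := fun _ _ => (hik' _ _).ne'
  have ejk : ∀ α β, r (j, α) ≠ r (k, β) := fun _ _ => (hjk' _ _).ne
  have ekj : ∀ α β, r (k, α) ≠ r (j, β) := fun _ _ => (hjk' _ _).ne'
  have hub := F.hub
  have hcr : ∀ s, c ≠ r s := fun s => (hub s).ne
  have hrc : ∀ s, r s ≠ c := fun s => (hub s).ne'
  have hc1 : c ∉ X₁ := fun h => F.hub_notMem (h₁ h)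
  have hc2 : c ∉ X₂ := fun h => F.hub_notMem (h₂ h)
  have hi0 := hi α
  have hi1 := hi (α + 1)
  have hkj : ∀ α β, G.Adj (r (k, α)) (r (j, β)) := fun _ _ => (hjk' _ _).symm
  refine isMinor_K7vee (C := bags c r X₁ i j k α β γ) (S := X₂) (i := 0) (j := e) ?_ ?_ ?_ hc₂ ?_ he
    ?_
  · obtain ⟨x, hx, hxa⟩ := hi0
    intro l
    fin_cases l
    on_goal 2 => exact (conn_singleton G _).union hc₁ ⟨_, rfl, x, hx, hxa.symm⟩
    on_goal 5 =>
      exact (conn_singleton G _).union (conn_singleton G _) ⟨_, rfl, _, rfl, hjk' _ _⟩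
    all_goals exact conn_singleton G _
  · intro l m hlm
    fin_cases l <;> fin_cases m <;> first | exact absurd hlm (by decide) | simp [bags, *]
  · intro l m hlm
    fin_cases l <;> fin_cases m <;> first | exact absurd hlm (by decide) | simp [bags, *]
  · intro l
    fin_cases l <;> simp [bags, hd.symm, *]
  · intro l hl hle
    obtain rfl | h2 : l = 1 ∨ 2 ≤ l := by omega
    · obtain ⟨x, hx, y, hy, hxy⟩ := hadj
      exact ⟨y, hy, x, Or.inr hx, hxy.symm⟩
    · exact hX₂ l h2 hle

theorem ncard_att_diff_le (F : OctaFrame G X c r) (hG : ¬ IsMinor K7vee G) (h₁ : X₁ ⊆ X)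
    (h₂ : X₂ ⊆ X) (hc₁ : Conn G X₁) (hc₂ : Conn G X₂) (hd : Disjoint X₁ X₂)
    (hadj : ∃ x ∈ X₁, ∃ y ∈ X₂, G.Adj x y) {i : Fin 3}
    (hi : ∀ ε, r (i, ε) ∈ att G (Set.range r) X₁) (α : Fin 2) :
    (att G (Set.range r) X₂ \ {r (i, α)}).ncard ≤ 2 := by
  replace hi : ∀ ε, ∃ x ∈ X₁, G.Adj x (r (i, ε)) := fun ε => (hi ε).2
  let A : Fin 3 × Fin 2 → Prop := fun s => ∃ x ∈ X₂, G.Adj x (r s)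
  have key : ∀ {j k : Fin 3} (β γ : Fin 2) (e : Fin 6), i ≠ j → i ≠ k → j ≠ k → 0 ≠ e →
      (2 ≠ e → A (i, α + 1)) → (3 ≠ e → A (j, β)) → (4 ≠ e → A (k, γ)) →
      (5 ≠ e → A (j, β + 1) ∨ A (k, γ + 1)) → False := by
    intro j k β γ e hij hik hjk he h2 h3 h4 h5
    refine hG (F.isMinor h₁ h₂ hc₁ hc₂ hd hadj hij hik hjk (α := α) (β := β) (γ := γ) hi he ?_)
    intro l hl hle
    obtain rfl | rfl | rfl | rfl : l = 2 ∨ l = 3 ∨ l = 4 ∨ l = 5 := by omega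
    · obtain ⟨x, hx, hxr⟩ := h2 hle
      exact ⟨x, hx, _, rfl, hxr⟩
    · obtain ⟨x, hx, hxr⟩ := h3 hle
      exact ⟨x, hx, _, rfl, hxr⟩
    · obtain ⟨x, hx, hxr⟩ := h4 hle
      exact ⟨x, hx, _, rfl, hxr⟩
    · obtain ⟨x, hx, hxr⟩ | ⟨x, hx, hxr⟩ := h5 hle
      · exact ⟨x, hx, _, Or.inl rfl, hxr⟩
      · exact ⟨x, hx, _, Or.inr rfl, hxr⟩
  have hthird : ∀ i j : Fin 3, i ≠ j → ∃ k, i ≠ k ∧ j ≠ k := by decide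
  have hsucc : ∀ β γ : Fin 2, β ≠ γ → γ = β + 1 := by decide
  -- one of three vertices is the antipode of the deleted one
  have hanti : ∀ s t : Fin 3 × Fin 2, s ≠ t → i ≠ s.1 → i ≠ t.1 → A (i, α + 1) → A s → A t →
      False := by
    rintro ⟨j, β⟩ ⟨k, γ⟩ hst hj hk h1 h2 h3
    by_cases hjk : j = k
    · subst hjk
      obtain rfl := hsucc β γ fun h => hst (by rw [h])
      obtain ⟨k, hik, hjk⟩ := hthird i j hj
      exact key β 0 4 hj hik hjk (by decide) (fun _ => h1) (fun _ => h2) (fun h => absurd rfl h)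
        fun _ => Or.inl h3
    · exact key β γ 5 hj hk hjk (by decide) (fun _ => h1) (fun _ => h2) (fun _ => h3)
        fun h => absurd rfl h
  -- two of three vertices are antipodal to each other
  have hpair : ∀ s t u : Fin 3 × Fin 2, s ≠ t → s.1 = t.1 → s.1 ≠ u.1 → i ≠ s.1 → i ≠ u.1 →
      A s → A t → A u → False := by
    rintro ⟨j, β⟩ ⟨j', β'⟩ ⟨k, γ⟩ hst rfl hjk hj hk h1 h2 h3
    obtain rfl := hsucc β β' fun h => hst (by rw [h])
    exact key β γ 2 hj hk hjk (by decide) (fun h => absurd rfl h) (fun _ => h1) (fun _ => h3)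
      fun _ => Or.inl h2
  have hfst : ∀ s : Fin 3 × Fin 2, s ≠ (i, α) → i = s.1 → s = (i, α + 1) := by
    rintro ⟨j, β⟩ hs rfl
    rw [hsucc α β fun h => hs (by rw [h])]
  by_contra hlt
  rw [not_le, Set.two_lt_ncard_iff
    ((Set.finite_range r).subset (Set.sdiff_subset.trans fun x hx => hx.1))] at hlt
  obtain ⟨_, _, _, ⟨⟨⟨s, rfl⟩, hs⟩, hs'⟩, ⟨⟨⟨t, rfl⟩, ht⟩, ht'⟩, ⟨⟨⟨u, rfl⟩, hu⟩, hu'⟩, hst, hsu,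
    htu⟩ := hlt
  replace hst : s ≠ t := fun h => hst (by rw [h])
  replace hsu : s ≠ u := fun h => hsu (by rw [h])
  replace htu : t ≠ u := fun h => htu (by rw [h])
  replace hs' : s ≠ (i, α) := fun h => hs' (by rw [h]; rfl)
  replace ht' : t ≠ (i, α) := fun h => ht' (by rw [h]; rfl)
  replace hu' : u ≠ (i, α) := fun h => hu' (by rw [h]; rfl)
  have hone : ∀ s t u : Fin 3 × Fin 2, s ≠ (i, α) → t ≠ (i, α) → u ≠ (i, α) → s ≠ t → s ≠ u →
      t ≠ u → A s → A t → A u → i = s.1 → False := by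
    intro s t u hs ht hu hst hsu htu h1 h2 h3 his
    have hs2 := hfst s hs his
    refine hanti t u htu (fun h => ?_) (fun h => ?_) (hs2 ▸ h1) h2 h3
    · exact hst (hs2.trans (hfst t ht h).symm)
    · exact hsu (hs2.trans (hfst u hu h).symm)
  by_cases h1 : i = s.1
  · exact hone s t u hs' ht' hu' hst hsu htu hs ht hu h1
  by_cases h2 : i = t.1
  · exact hone t s u ht' hs' hu' hst.symm htu hsu ht hs hu h2
  by_cases h3 : i = u.1
  · exact hone u s t hu' hs' ht' hsu.symm htu.symm hst hu hs ht h3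
  by_cases h4 : s.1 = t.1
  · by_cases h5 : s.1 = u.1
    · have h6 := hsucc s.2 t.2 fun h => hst (Prod.ext h4 h)
      have h7 := hsucc s.2 u.2 fun h => hsu (Prod.ext h5 h)
      exact htu (Prod.ext (h4.symm.trans h5) (h6.trans h7.symm))
    · exact hpair s t u hst h4 h5 h1 h3 hs ht hu
  by_cases h5 : s.1 = u.1
  · exact hpair s u t hsu h5 h4 h1 h2 hs hu ht
  · exact hpair t u s htu (by omega) (Ne.symm h4) h2 h1 ht hu hs

theorem exists_of_four_le (F : OctaFrame G X c r) {N : Set V} (hN : N ⊆ Set.range r)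
    (h4 : 4 ≤ N.ncard) : ∃ i, ∀ ε, r (i, ε) ∈ N := by
  rw [← Set.ncard_preimage_of_injective_subset_range F.inj hN] at h4
  have h3 : (Set.univ : Set (Fin 3)).ncard < (r ⁻¹' N).ncard := by
    rw [Set.ncard_univ, Nat.card_fin]
    omega
  obtain ⟨s, hs, t, ht, hst, h⟩ := Set.exists_ne_map_eq_of_ncard_lt_of_maps_to (f := Prod.fst) h3
    fun _ _ => Set.mem_univ _
  have hε : ∀ a b ε : Fin 2, a ≠ b → ε = a ∨ ε = b := by decide
  refine ⟨s.1, fun ε => ?_⟩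
  rcases hε s.2 t.2 ε fun h' => hst (Prod.ext h h') with rfl | rfl
  · exact hs
  · rw [h]
    exact ht

theorem ncard_range (F : OctaFrame G X c r) : (Set.range r).ncard = 6 := by
  rw [← Set.image_univ, Set.ncard_image_of_injective _ F.inj, Set.ncard_univ]
  simp

theorem not_four_le (F : OctaFrame G X c r) (hG : ¬ IsMinor K7vee G) (h₁ : X₁ ⊆ X)
    (h₂ : X₂ ⊆ X) (hc₁ : Conn G X₁) (hc₂ : Conn G X₂) (hd : Disjoint X₁ X₂)
    (hadj : ∃ x ∈ X₁, ∃ y ∈ X₂, G.Adj x y) (h4 : 4 ≤ (att G (Set.range r) X₁).ncard)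
    (h3 : 3 ≤ (att G (Set.range r) X₂).ncard) : False := by
  have hsub : ∀ Y, att G (Set.range r) Y ⊆ Set.range r := fun Y x hx => hx.1
  obtain ⟨i, hi⟩ := F.exists_of_four_le (hsub _) h4
  have hadj' : ∃ x ∈ X₂, ∃ y ∈ X₁, G.Adj x y := by
    obtain ⟨x, hx, y, hy, hxy⟩ := hadj
    exact ⟨y, hy, x, hx, hxy.symm⟩
  have hmem : ∀ ε, r (i, ε) ∈ att G (Set.range r) X₂ := by
    intro ε
    by_contra hn
    have := F.ncard_att_diff_le hG h₁ h₂ hc₁ hc₂ hd hadj hi ε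
    rw [Set.sdiff_singleton_eq_self hn] at this
    omega
  have h5 := F.ncard_att_diff_le hG h₂ h₁ hc₂ hc₁ hd.symm hadj' hmem 0
  rw [Set.ncard_sdiff_singleton_of_mem (hi 0)] at h5
  omega

theorem split (F : OctaFrame G X c r) (hG : ¬ IsMinor K7vee G) (hX : Conn G X)
    (hatt : att G (Set.range r) X = Set.range r) {Y : Set V} (hY : Y ⊆ X) (hc₁ : Conn G Y)
    (hc₂ : Conn G (X \ Y)) :
    (att G (Set.range r) Y).ncard ≤ 2 ∨ (att G (Set.range r) (X \ Y)).ncard ≤ 2 ∨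
      (Disjoint (att G (Set.range r) Y) (att G (Set.range r) (X \ Y)) ∧
        (att G (Set.range r) Y).ncard = 3 ∧ (att G (Set.range r) (X \ Y)).ncard = 3) := by
  have hadj := hX.2 Y hY hc₁.1 hc₂.1
  have hadj' : ∃ x ∈ X \ Y, ∃ y ∈ Y, G.Adj x y := by
    obtain ⟨x, hx, y, hy, hxy⟩ := hadj
    exact ⟨y, hy, x, hx, hxy.symm⟩
  have hd : Disjoint Y (X \ Y) := Set.disjoint_sdiff_right
  by_contra! hn
  obtain ⟨h1, h2, h3⟩ := hn
  have h4 : ¬ 4 ≤ _ := fun h => F.not_four_le hG hY Set.sdiff_subset hc₁ hc₂ hd hadj h h2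
  have h5 : ¬ 4 ≤ _ := fun h => F.not_four_le hG Set.sdiff_subset hY hc₂ hc₁ hd.symm hadj' h h1
  have hfin : ∀ Z, (att G (Set.range r) Z).Finite := fun Z =>
    (Set.finite_range r).subset fun x hx => hx.1
  have h6 := Set.ncard_union_add_ncard_inter _ _ (hfin Y) (hfin (X \ Y))
  rw [← att_union, Set.union_sdiff_cancel hY, hatt, F.ncard_range] at h6
  refine h3 ?_ (by omega) (by omega)
  rw [Set.disjoint_iff_inter_eq_empty, ← Set.ncard_eq_zero ((hfin Y).inter_of_left _)]
  omega

end OctaFrame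
end OctaFrame

section Main

variable {V : Type} {G : SimpleGraph V} {X : Set V}

theorem IsMaxContr.exists_octaFrame [Fintype V] (h : MinorMinimalEnemy G) (hX : IsMaxContr G X) :
    ∃ c r, OctaFrame G X c r ∧ Set.range r = bdry G X ∧ (∀ v, v ∉ X → v = c ∨ v ∈ Set.range r) ∧
      ∀ s t, G.Adj (r s) (r t) → s.1 ≠ t.1 := by
  obtain ⟨φ₀⟩ := h.iso_contr hX.conn hX.two_le hX.two_le_compl hX.rho_nonneg (hX.bdry4_contr h)
  obtain ⟨φ, h0⟩ := exists_iso_root φ₀ none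
  obtain ⟨r, hr⟩ := exists_real φ h0
  have hadj : ∀ s t, s ≠ (0, 0) → t ≠ (0, 0) → (G.Adj (r s) (r t) ↔ s.1 ≠ t.1) := by
    intro s t hs ht
    obtain ⟨h3, h4⟩ := hr s hs
    obtain ⟨h5, h6⟩ := hr t ht
    rw [← K2222_adj, ← φ.map_adj_iff, h4, h6, contr_some_some]
  have hbd : ∀ t, t ≠ (0, 0) → (r t ∈ bdry G X ↔ t.1 ≠ 0) := by
    intro t ht
    obtain ⟨h3, h4⟩ := hr t ht
    have h5 := φ.map_adj_iff (v := (0, 0)) (w := t)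
    rw [h0, h4, contr_none_some, K2222_adj] at h5
    exact h5.trans ne_comm
  have hinj : ∀ s t, s ≠ (0, 0) → t ≠ (0, 0) → r s = r t → s = t := by
    intro s t hs ht hst
    obtain ⟨h1, h2⟩ := hr s hs
    obtain ⟨h3, h4⟩ := hr t ht
    apply φ.injective
    rw [h2, h4]
    simp [hst]
  have hsurj : ∀ v, v ∉ X → ∃ t, t ≠ (0, 0) ∧ r t = v := by
    intro v hv
    obtain ⟨t, ht⟩ := φ.surjective (some ⟨v, hv⟩)
    have ht0 : t ≠ (0, 0) := by
      rintro rfl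
      rw [h0] at ht
      exact absurd ht (by simp)
    obtain ⟨h3, h4⟩ := hr t ht0
    rw [ht] at h4
    exact ⟨t, ht0, by simpa using h4.symm⟩
  have hne : ∀ s : Fin 3 × Fin 2, (s.1.succ, s.2) ≠ ((0, 0) : Fin 4 × Fin 2) := by decide
  have hcases : ∀ t : Fin 4 × Fin 2, t ≠ (0, 0) → t = (0, 1) ∨
      ∃ s : Fin 3 × Fin 2, t = (s.1.succ, s.2) := by decide
  have h01 : ((0, 1) : Fin 4 × Fin 2) ≠ (0, 0) := by decide
  refine ⟨r (0, 1), fun s => r (s.1.succ, s.2), ⟨?_, ?_, ?_, ?_, ?_⟩, ?_, ?_, ?_⟩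
  · intro s t hst
    have h1 := hinj _ _ (hne s) (hne t) hst
    rw [Prod.mk.injEq] at h1
    exact Prod.ext (Fin.succ_injective _ h1.1) h1.2
  · exact fun s t hst => (hadj _ _ (hne s) (hne t)).2 fun h => hst (Fin.succ_injective _ h)
  · exact fun s => (hadj _ _ h01 (hne s)).2 (Fin.succ_ne_zero _).symm
  · exact (hr _ h01).1
  · exact fun s => (hr _ (hne s)).1
  · ext v
    constructor
    · rintro ⟨s, rfl⟩
      exact (hbd _ (hne s)).2 (Fin.succ_ne_zero _)
    · intro hv
      obtain ⟨t, ht, rfl⟩ := hsurj v hv.1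
      rcases hcases t ht with rfl | ⟨s, rfl⟩
      · exact absurd rfl ((hbd _ ht).1 hv)
      · exact ⟨s, rfl⟩
  · intro v hv
    obtain ⟨t, ht, rfl⟩ := hsurj v hv
    rcases hcases t ht with rfl | ⟨s, rfl⟩
    · exact Or.inl rfl
    · exact Or.inr ⟨s, rfl⟩
  · intro s t hst h
    exact (hadj _ _ (hne s) (hne t)).1 hst (congrArg Fin.succ h)

/-- If contracting the edge `ow` creates no small cut, then `o` and `w` have at least three common
neighbours. -/
theorem MinorMinimalEnemy.three_le_common [Fintype V] (h : MinorMinimalEnemy G) {o w : V}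
    (how : G.Adj o w) (hb : Bdry4 (contr G {o, w})) :
    3 ≤ (G.neighborSet o ∩ G.neighborSet w).ncard := by
  by_contra hlt
  have hrho := rho_pair how
  have hexc := h.excess_nonneg
  have hpair := Set.ncard_pair how.ne
  have hpc := Set.ncard_add_ncard_compl ({o, w} : Set V)
  have h5 := h.five_le_card
  obtain ⟨ψ⟩ := h.iso_contr (conn_pair how) hpair.ge (by omega) (by omega) hb
  have h1 := excess_iso ψ
  rw [excess_K2222, excess_contr] at h1
  omega

theorem IsMaxContr.octaSide [Fintype V] (h : MinorMinimalEnemy G) (hX : IsMaxContr G X) :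
    OctaSide G X (bdry G X) := by
  obtain ⟨c, r, F, hO, hcov, hnadj⟩ := hX.exists_octaFrame h
  have hG := h.bdry4
  have hatt : att G (bdry G X) X = bdry G X :=
    Set.Subset.antisymm (fun o ho => ho.1) fun o ho => ⟨ho, ho.2⟩
  have hc : ∀ x ∈ X, ¬ G.Adj x c := by
    intro x hx hxc
    have hcb : c ∈ bdry G X := ⟨F.hub_notMem, x, hx, hxc⟩
    rw [← hO] at hcb
    obtain ⟨s, hs⟩ := hcb
    exact (F.hub s).ne' hs
  refine ⟨hX.conn, hX.two_le, by rw [← hO, F.ncard_range], hatt, ?_, ?_, ?_⟩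
  · intro Y hY hne
    have h1 := hG Y hne ⟨c, fun hcY => F.hub_notMem (hY hcY), fun hcb => by
      obtain ⟨-, y, hy, hyc⟩ := hcb
      exact hc y (hY hy) hyc⟩
    have h2 : bdry G Y ⊆ (X ∩ bdry G Y) ∪ att G (bdry G X) Y := by
      intro v hv
      by_cases hvX : v ∈ X
      · exact Or.inl ⟨hvX, hv⟩
      · obtain ⟨-, y, hy, hyv⟩ := hv
        exact Or.inr ⟨⟨hvX, y, hY hy, hyv⟩, y, hy, hyv⟩
    exact h1.trans ((Set.ncard_le_ncard h2).trans (Set.ncard_union_le _ _))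
  · rw [← hO] at hatt ⊢
    exact fun Y hY hc₁ hc₂ => F.split h.1.2.2.1 hX.conn hatt hY hc₁ hc₂
  · intro o ho w hw hwo huniq
    rw [← hO] at ho
    obtain ⟨⟨i, ε⟩, rfl⟩ := ho
    have hind : ∀ i : Fin 3, ∃ k l, i ≠ k ∧ i ≠ l ∧ k ≠ l ∧ ∀ j, j ≠ i → j = k ∨ j = l := by decide
    obtain ⟨k, l, hik, hil, hkl, hj⟩ := hind i
    have hwheel : IsWheel G c (r (k, 0)) (r (k, 1)) (r (l, 0)) (r (l, 1)) := by
      constructor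
      on_goal 9 => exact F.ne_succ k 0
      on_goal 9 => exact F.ne_succ l 0
      all_goals first | exact F.hub _ | exact F.adj _ _ hkl
    have hnb : ∀ x, G.Adj (r (i, ε)) x →
        x = w ∨ x ∈ ({c, r (k, 0), r (k, 1), r (l, 0), r (l, 1)} : Set V) := by
      intro x hx
      by_cases hxX : x ∈ X
      · exact Or.inl (huniq x hxX hx.symm)
      · right
        obtain rfl | ⟨⟨j, δ⟩, rfl⟩ := hcov x hxX
        · exact Or.inl rfl
        · have hδ : ∀ δ : Fin 2, δ = 0 ∨ δ = 1 := by decide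
          rcases hj j (hnadj _ _ hx).symm with rfl | rfl <;> rcases hδ δ with rfl | rfl <;> simp
    have hb : Bdry4 (contr G {r (i, ε), w}) := by
      refine bdry4_contr_of_wheel hG hwheel ?_ hnb
      have hkeep : ∀ j δ, i ≠ j → r (j, δ) ∉ ({r (i, ε), w} : Set V) := by
        rintro j δ hij (h | h)
        · exact (F.adj (i, ε) (j, δ) hij).ne' h
        · exact F.notMem _ (Set.mem_singleton_iff.1 h ▸ hw)
      rintro x (rfl | rfl | rfl | rfl | rfl)
      · rintro (h | h)
        · exact (F.hub _).ne h
        · exact F.hub_notMem (Set.mem_singleton_iff.1 h ▸ hw)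
      · exact hkeep _ _ hik
      · exact hkeep _ _ hik
      · exact hkeep _ _ hil
      · exact hkeep _ _ hil
    have h3 := h.three_le_common hwo.symm hb
    have hmem : r (i, ε) ∈ att G (bdry G X) {w} :=
      ⟨hO ▸ Set.mem_range_self _, w, rfl, hwo⟩
    have hsub : insert (r (i, ε)) (G.neighborSet (r (i, ε)) ∩ G.neighborSet w) ⊆
        att G (bdry G X) {w} := by
      rintro x (rfl | ⟨hx1, hx2⟩)
      · exact hmem
      · have hxX : x ∉ X := by
          intro hxX
          obtain rfl := huniq x hxX hx1.symm
          exact SimpleGraph.irrefl _ hx2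
        exact ⟨⟨hxX, w, hw, hx2⟩, w, rfl, hx2⟩
    have h4 := Set.ncard_le_ncard hsub
    rw [Set.ncard_insert_of_notMem fun hx => SimpleGraph.irrefl _ hx.1] at h4
    omega

theorem MinorMinimalEnemy.not_isMaxContr [Fintype V] (h : MinorMinimalEnemy G) :
    ¬ IsMaxContr G X :=
  fun hX => (hX.octaSide h).elim

theorem MinorMinimalEnemy.exists_isMaxContr [Fintype V] (h : MinorMinimalEnemy G) {u v : V}
    (huv : G.Adj u v) (hc : (G.neighborSet u ∩ G.neighborSet v).ncard ≤ 3) :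
    ∃ X, IsMaxContr G X := by
  have hpair := Set.ncard_pair huv.ne
  have hpc := Set.ncard_add_ncard_compl ({u, v} : Set V)
  have h5 := h.five_le_card
  have hrho := rho_pair huv
  have hexc := h.excess_nonneg
  obtain ⟨X, ⟨h1, h2, h3, h4⟩, hmax⟩ := exists_max_set
    (fun Z => Conn G Z ∧ 2 ≤ Z.ncard ∧ 2 ≤ Zᶜ.ncard ∧ 0 ≤ rho G Z)
    ⟨{u, v}, conn_pair huv, hpair.ge, by omega, by omega⟩
  refine ⟨X, h1, h2, h3, h4, fun Z hZ hlt hZc => ?_⟩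
  by_contra hn
  have := hmax Z ⟨hZ, by omega, hZc, by omega⟩
  omega

end Main

/-- in a minor-minimal enemy, the ends of every edge have at least four
common neighbors. -/
theorem statement_12 (V : Type) [Fintype V] (G : SimpleGraph V)
    (h : MinorMinimalEnemy G) (u v : V) (huv : G.Adj u v) :
    4 ≤ (G.neighborSet u ∩ G.neighborSet v).ncard := by
  by_contra hc
  obtain ⟨X, hX⟩ := h.exists_isMaxContr huv (by omega)
  exact h.not_isMaxContr hX
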